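/- The kernel of ψ_C : C → S₁₈ is isomorphic to the group K = ker(ab). -/

import Mathlib

/-- The vertices of the graph `T`: the 18 triangles of the triangulation of
the torus obtained from the 3×3 square grid with opposite sides identified.
A triangle is labelled by its unit cell `(a, b) : (ℤ/3)²` together with a
Boolean which is `false` for the lower triangle (below the diagonal of the
cell) and `true` for the upper one. -/
abbrev VT : Type := (ZMod 3 × ZMod 3) × Bool

/-- The 27 edges of the graph `T`, joining pairs of distinct triangles which
share a common side: edge `(c, 0)` is dual to the diagonal of the cell `c`,
edge `(c, 1)` to the left side of `c` and edge `(c, 2)` to the bottom side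
of `c`. -/
abbrev ET : Type := (ZMod 3 × ZMod 3) × Fin 3

/-- One endpoint of an edge of `T`. -/
def endA (e : ET) : VT :=
  if e.2 = 1 then (e.1, true) else (e.1, false)

/-- The other endpoint of an edge of `T`. -/
def endB (e : ET) : VT :=
  if e.2 = 0 then (e.1, true)
  else if e.2 = 1 then ((e.1.1 - 1, e.1.2), false)
  else ((e.1.1, e.1.2 - 1), true)

/-- Incidence between edges and vertices of `T`. -/
def incidentT (e : ET) (v : VT) : Prop := v = endA e ∨ v = endB e

/-- For each of the 9 grid vertices `p` of the torus, the six edges (in cyclic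
order) of the hexagonal cycle in `T` formed by the six triangles
containing `p`. -/
def hexEdge (p : ZMod 3 × ZMod 3) : Fin 6 → ET := fun k =>
  if k = 0 then (p, 2)
  else if k = 1 then (p, 0)
  else if k = 2 then (p, 1)
  else if k = 3 then ((p.1 - 1, p.2), 2)
  else if k = 4 then ((p.1 - 1, p.2 - 1), 0)
  else ((p.1, p.2 - 1), 1)

/-- The free-group generator corresponding to an edge `e` of `T`. -/
def fe (e : ET) : FreeGroup ET := FreeGroup.of e

/-- The relations of the presentation of the group `C`: `u_e² = 1`;
`u_e u_f = u_f u_e` when `e, f` have no common vertex;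
`u_e u_f u_e = u_f u_e u_f` when `e, f` share exactly one vertex; and the
cyclic relation `u_{e₁} u_{e₂} u_{e₃} u_{e₄} u_{e₅} = u_{e₂} u_{e₃} u_{e₄} u_{e₅} u_{e₆}`
for each of the nine hexagonal cycles. -/
def CRels : Set (FreeGroup ET) :=
  { r | (∃ e : ET, r = fe e * fe e)
      ∨ (∃ e f : ET, (∀ v : VT, ¬ (incidentT e v ∧ incidentT f v)) ∧
            r = fe e * fe f * (fe f * fe e)⁻¹)
      ∨ (∃ e f : ET, (∃! v : VT, incidentT e v ∧ incidentT f v) ∧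
            r = fe e * fe f * fe e * (fe f * fe e * fe f)⁻¹)
      ∨ (∃ p : ZMod 3 × ZMod 3,
            r = (fe (hexEdge p 0) * fe (hexEdge p 1) * fe (hexEdge p 2) *
                 fe (hexEdge p 3) * fe (hexEdge p 4)) *
                (fe (hexEdge p 1) * fe (hexEdge p 2) * fe (hexEdge p 3) *
                 fe (hexEdge p 4) * fe (hexEdge p 5))⁻¹) }

/-- The group `C`, given by the above presentation. -/
abbrev Cgrp : Type := PresentedGroup CRels

/-- The generator `u_e` of `C` corresponding to the edge `e` of `T`. -/
def uC (e : ET) : Cgrp := PresentedGroup.of e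

/-- The transposition in `S₁₈` exchanging the two triangles joined by the
edge `e` of `T`. -/
def tE (e : ET) : Equiv.Perm VT := Equiv.swap (endA e) (endB e)

/-- Generators of the group `H`: `x i`, `y i` for `i : Fin 18`, and `z`. -/
inductive HGen : Type
  | x : Fin 18 → HGen
  | y : Fin 18 → HGen
  | z : HGen

/-- The free-group generator corresponding to `x i`. -/
def fx (i : Fin 18) : FreeGroup HGen := FreeGroup.of (HGen.x i)
/-- The free-group generator corresponding to `y i`. -/
def fy (i : Fin 18) : FreeGroup HGen := FreeGroup.of (HGen.y i)
/-- The free-group generator corresponding to `z`. -/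
def fz : FreeGroup HGen := FreeGroup.of HGen.z

/-- The relations of the presentation of `H`:
`[xᵢ, xⱼ] = [yᵢ, yⱼ] = [xᵢ, yⱼ] = 1` for `i ≠ j`, `[xᵢ, yᵢ] = z`,
and `z` commutes with all the generators. -/
def HRels : Set (FreeGroup HGen) :=
  { r | (∃ i j : Fin 18, i ≠ j ∧ r = fx i * fx j * (fx i)⁻¹ * (fx j)⁻¹)
      ∨ (∃ i j : Fin 18, i ≠ j ∧ r = fy i * fy j * (fy i)⁻¹ * (fy j)⁻¹)
      ∨ (∃ i j : Fin 18, i ≠ j ∧ r = fx i * fy j * (fx i)⁻¹ * (fy j)⁻¹)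
      ∨ (∃ i : Fin 18, r = fx i * fy i * (fx i)⁻¹ * (fy i)⁻¹ * fz⁻¹)
      ∨ (∃ i : Fin 18, r = fx i * fz * (fx i)⁻¹ * fz⁻¹)
      ∨ (∃ i : Fin 18, r = fy i * fz * (fy i)⁻¹ * fz⁻¹) }

/-- The group `H`, given by the above presentation. -/
abbrev Hgrp : Type := PresentedGroup HRels

/-- The generator `xᵢ` of `H`. -/
def xH (i : Fin 18) : Hgrp := PresentedGroup.of (HGen.x i)
/-- The generator `yᵢ` of `H`. -/
def yH (i : Fin 18) : Hgrp := PresentedGroup.of (HGen.y i)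
/-- The generator `z` of `H`. -/
def zH : Hgrp := PresentedGroup.of HGen.z

open Equiv

section CoxeterTypeA

/-- The product `s (a + m - 1) * ⋯ * s (a + 1) * s a`. -/
def descProd {E : Type*} [Group E] (s : ℕ → E) (a : ℕ) : ℕ → E
  | 0 => 1
  | m + 1 => s (a + m) * descProd s a m

variable {E : Type*} [Group E] {s : ℕ → E} {n : ℕ}

theorem descProd_commute_of_lt {a m i : ℕ} (h : ∀ k < m, Commute (s i) (s (a + k))) :
    Commute (s i) (descProd s a m) := by
  induction m with
  | zero => exact Commute.one_right _
  | succ m ih => exact (h m (by omega)).mul_right (ih fun k hk => h k (by omega))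

theorem mul_descProd_of_lt {a m i : ℕ}
    (comm : ∀ i j, i + 1 < j → j < n → s i * s j = s j * s i)
    (braid : ∀ i, i + 1 < n → s i * s (i + 1) * s i = s (i + 1) * s i * s (i + 1))
    (hm : a + m ≤ n) (hai : a ≤ i) (him : i + 1 < a + m) :
    s i * descProd s a m = descProd s a m * s (i + 1) := by
  induction m with
  | zero => omega
  | succ m ih =>
    rcases Nat.lt_or_ge (i + 1) (a + m) with h | h
    · simp only [descProd]
      rw [← mul_assoc, comm i (a + m) h (by omega), mul_assoc, ih (by omega) h, mul_assoc]
    · obtain ⟨k, rfl⟩ : ∃ k, m = k + 1 := ⟨m - 1, by omega⟩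
      obtain rfl : i = a + k := by omega
      have hc : Commute (s (a + k + 1)) (descProd s a k) :=
        descProd_commute_of_lt fun l hl => (comm (a + l) (a + k + 1) (by omega) (by omega)).symm
      simp only [descProd]
      rw [← add_assoc a k 1, mul_assoc, mul_assoc, ← hc.eq]
      simp only [← mul_assoc]
      rw [braid (a + k) (by omega)]

theorem exists_descProd_mul_of_mem_closure {a : ℕ}
    (sq : ∀ i < n, s i * s i = 1)
    (comm : ∀ i j, i + 1 < j → j < n → s i * s j = s j * s i)
    (braid : ∀ i, i + 1 < n → s i * s (i + 1) * s i = s (i + 1) * s i * s (i + 1))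
    (han : a ≤ n) {g : E} (hg : g ∈ Subgroup.closure (s '' Set.Ico a n)) :
    ∃ m, a + m ≤ n ∧ ∃ c ∈ Subgroup.closure (s '' Set.Ico (a + 1) n),
      g = descProd s a m * c := by
  have key : ∀ x ∈ s '' Set.Ico a n, ∀ y, (∃ m, a + m ≤ n ∧
      ∃ c ∈ Subgroup.closure (s '' Set.Ico (a + 1) n), y = descProd s a m * c) →
      ∃ m, a + m ≤ n ∧
      ∃ c ∈ Subgroup.closure (s '' Set.Ico (a + 1) n), x * y = descProd s a m * c := by
    rintro _ ⟨i, ⟨hai, hin⟩, rfl⟩ _ ⟨m, hm, c, hc, rfl⟩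
    rcases lt_trichotomy i (a + m) with h | h | h
    · rcases Nat.lt_or_ge (i + 1) (a + m) with h' | h'
      · refine ⟨m, hm, s (i + 1) * c, mul_mem (Subgroup.subset_closure
          ⟨i + 1, ⟨by omega, by omega⟩, rfl⟩) hc, ?_⟩
        rw [← mul_assoc, mul_descProd_of_lt comm braid hm hai h', mul_assoc]
      · obtain ⟨k, rfl⟩ : ∃ k, m = k + 1 := ⟨m - 1, by omega⟩
        obtain rfl : i = a + k := by omega
        refine ⟨k, by omega, c, hc, ?_⟩
        simp only [descProd]
        rw [← mul_assoc, ← mul_assoc, sq _ hin, one_mul]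
    · subst h
      exact ⟨m + 1, by omega, c, hc, by simp only [descProd, mul_assoc]⟩
    · refine ⟨m, hm, s i * c, mul_mem (Subgroup.subset_closure
          ⟨i, ⟨by omega, by omega⟩, rfl⟩) hc, ?_⟩
      have hco : Commute (s i) (descProd s a m) :=
        descProd_commute_of_lt fun k hk => (comm (a + k) i (by omega) hin).symm
      rw [← mul_assoc, hco.eq, mul_assoc]
  induction hg using Subgroup.closure_induction_left with
  | one => exact ⟨0, by omega, 1, one_mem _, by simp [descProd]⟩
  | mul_left x hx y _ ih => exact key x hx y ih
  | inv_mul_cancel x hx y _ ih =>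
    have : x⁻¹ = x := by
      obtain ⟨i, hi, rfl⟩ := hx
      exact inv_eq_of_mul_eq_one_left (sq i hi.2)
    rw [this]
    exact key x hx y ih

/-- The symmetric group is the Coxeter group of type `A`: elements of a group which satisfy the
Coxeter relations of type `A` are the images of adjacent transpositions. -/
theorem Equiv.Perm.exists_hom_of_coxeter {G α : Type*} [Group G] [DecidableEq α] [Finite α]
    (v : Fin (n + 1) ≃ α) (s : ℕ → G) (sq : ∀ i < n, s i * s i = 1)
    (comm : ∀ i j, i + 1 < j → j < n → s i * s j = s j * s i)
    (braid : ∀ i, i + 1 < n → s i * s (i + 1) * s i = s (i + 1) * s i * s (i + 1)) :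
    ∃ φ : Perm α →* G, ∀ i : Fin n, φ (swap (v i.castSucc) (v i.succ)) = s i := by
  let p : ℕ → α := fun i => v (Fin.ofNat (n + 1) i)
  have hp : ∀ i j, i ≤ n → j ≤ n → i ≠ j → p i ≠ p j := by
    intro i j hi hj hij h
    have := congrArg Fin.val (v.injective h)
    simp only [Fin.val_ofNat] at this
    rw [Nat.mod_eq_of_lt (by omega), Nat.mod_eq_of_lt (by omega)] at this
    exact hij this
  let S : ℕ → G × Perm α := fun i => (s i, swap (p i) (p (i + 1)))
  have Ssq : ∀ i < n, S i * S i = 1 := fun i hi => Prod.ext (sq i hi) (swap_mul_self _ _)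
  have Scomm : ∀ i j, i + 1 < j → j < n → S i * S j = S j * S i := by
    intro i j hij hj
    refine Prod.ext (comm i j hij hj) ?_
    have h1 := hp j i (by omega) (by omega) (by omega)
    have h2 := hp j (i + 1) (by omega) (by omega) (by omega)
    have h3 := hp (j + 1) i (by omega) (by omega) (by omega)
    have h4 := hp (j + 1) (i + 1) (by omega) (by omega) (by omega)
    change swap _ _ * swap _ _ = swap _ _ * swap _ _
    rw [mul_swap_eq_swap_mul, swap_apply_of_ne_of_ne h1 h2, swap_apply_of_ne_of_ne h3 h4]
  have Sbraid : ∀ i, i + 1 < n → S i * S (i + 1) * S i = S (i + 1) * S i * S (i + 1) := by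
    intro i hi
    refine Prod.ext (braid i hi) ?_
    have h1 := hp i (i + 1) (by omega) (by omega) (by omega)
    have h2 := hp i (i + 1 + 1) (by omega) (by omega) (by omega)
    have h3 := hp (i + 1) (i + 1 + 1) (by omega) (by omega) (by omega)
    change swap _ _ * swap _ _ * swap _ _ = swap _ _ * swap _ _ * swap _ _
    rw [swap_mul_swap_mul_swap h1 h2, swap_comm (p i) (p (i + 1)),
      swap_comm (p (i + 1)) (p (i + 1 + 1)), swap_mul_swap_mul_swap h3.symm h2.symm, swap_comm]
  have descProd_apply : ∀ a m, a + m ≤ n → (descProd S a m).2 (p a) = p (a + m) := by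
    intro a m h
    induction m with
    | zero => rfl
    | succ m ih =>
      change swap _ _ ((descProd S a m).2 (p a)) = _
      rw [ih (by omega), swap_apply_left, add_assoc]
  have fix : ∀ a, ∀ c ∈ Subgroup.closure (S '' Set.Ico (a + 1) n), c.2 (p a) = p a := by
    intro a c hc
    induction hc using Subgroup.closure_induction with
    | mem x hx =>
      obtain ⟨i, ⟨h1, h2⟩, rfl⟩ := hx
      exact swap_apply_of_ne_of_ne (hp _ _ (by omega) (by omega) (by omega))
        (hp _ _ (by omega) (by omega) (by omega))
    | one => rfl
    | mul x y _ _ hx hy =>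
      change x.2 (y.2 (p a)) = _
      rw [hy, hx]
    | inv x _ hx =>
      change x.2.symm (p a) = _
      rw [Equiv.symm_apply_eq, hx]
  have inj : ∀ k a, a + k = n → ∀ g ∈ Subgroup.closure (S '' Set.Ico a n), g.2 = 1 → g = 1 := by
    intro k
    induction k with
    | zero =>
      intro a ha g hg _
      simpa [show a = n by omega] using hg
    | succ k ih =>
      intro a ha g hg h1
      obtain ⟨m, hm, c, hc, rfl⟩ :=
        exists_descProd_mul_of_mem_closure Ssq Scomm Sbraid (by omega) hg
      have h2 : p (a + m) = p a := by
        rw [← descProd_apply a m hm, ← Perm.one_apply (p a), ← h1]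
        change (descProd S a m).2 _ = (descProd S a m).2 (c.2 (p a))
        rw [fix a c hc, h1, Perm.one_apply]
      obtain rfl : m = 0 := by
        by_contra hm0
        exact hp _ _ hm (by omega) (by omega) h2
      simp only [descProd, one_mul] at h1 ⊢
      exact ih (a + 1) (by omega) c hc h1
  let Γ := Subgroup.closure (S '' Set.Ico 0 n)
  let π : Γ →* Perm α := (MonoidHom.snd G (Perm α)).comp Γ.subtype
  have memΓ : ∀ i < n, S i ∈ Γ := fun i hi => Subgroup.subset_closure ⟨i, ⟨by omega, hi⟩, rfl⟩
  have hinj : Function.Injective π := by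
    rw [injective_iff_map_eq_one]
    intro g hg
    exact Subtype.ext (inj n 0 (by omega) g g.2 hg)
  have hsurj : Function.Surjective π := by
    rw [← MonoidHom.range_eq_top, eq_top_iff, ← Perm.closure_isSwap, Subgroup.closure_le]
    have step : ∀ i < n, swap (p i) (p (i + 1)) ∈ π.range := fun i hi => ⟨⟨S i, memΓ i hi⟩, rfl⟩
    have base : ∀ i ≤ n, swap (p 0) (p i) ∈ π.range := by
      intro i hi
      induction i with
      | zero => rw [swap_self]; exact one_mem _
      | succ i ih => exact SubmonoidClass.swap_mem_trans _ (ih (by omega)) (step i (by omega))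
    have all : ∀ x, swap (p 0) x ∈ π.range := by
      intro x
      have := base (v.symm x) (by omega)
      simpa [p] using this
    rintro _ ⟨x, y, _, rfl⟩
    exact SubmonoidClass.swap_mem_trans _ (swap_comm (p 0) x ▸ all x) (all y)
  let e := MulEquiv.ofBijective π ⟨hinj, hsurj⟩
  refine ⟨((MonoidHom.fst G (Perm α)).comp Γ.subtype).comp e.symm.toMonoidHom, fun i => ?_⟩
  have h1 : p i = v i.castSucc := congrArg v (Fin.ext (Nat.mod_eq_of_lt (by omega)))
  have h2 : p (i + 1) = v i.succ := congrArg v (Fin.ext (Nat.mod_eq_of_lt (by omega)))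
  have : e.symm (swap (v i.castSucc) (v i.succ)) = ⟨S i, memΓ i i.2⟩ := by
    rw [MulEquiv.symm_apply_eq, ← h1, ← h2]
    rfl
  simp [this, S]

end CoxeterTypeA

section FreeAbelian

variable {ι G : Type*} [Fintype ι] [DecidableEq ι] [Group G]

/-- A commuting family in a group extends to a homomorphism from a free abelian group. -/
theorem exists_hom_of_pairwise_commute (X : ι → G) (hX : ∀ i j, Commute (X i) (X j)) :
    ∃ F : Multiplicative (ι → ℤ) →* G,
      ∀ i n, F (Multiplicative.ofAdd (Pi.single i n)) = X i ^ n := by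
  let F := MonoidHom.noncommPiCoprod (fun i => zpowersHom G (X i))
    (fun i j _ x y => by simpa using (hX i j).zpow_zpow _ _)
  refine ⟨F.comp (MulEquiv.piMultiplicative fun _ : ι => ℤ).toMonoidHom, fun i n => ?_⟩
  have h : MulEquiv.piMultiplicative (fun _ : ι => ℤ) (Multiplicative.ofAdd (Pi.single i n)) =
      Pi.mulSingle i (Multiplicative.ofAdd n) := by
    ext j
    rcases eq_or_ne j i with rfl | h <;> simp [*]
  exact (congrArg F h).trans ((MonoidHom.noncommPiCoprod_mulSingle _ _ _).trans (by simp))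

theorem int_pi_induction {p : (ι → ℤ) → Prop} (zero : p 0) (single : ∀ i n, p (Pi.single i n))
    (add : ∀ a b, p a → p b → p (a + b)) (a : ι → ℤ) : p a := by
  rw [← Finset.univ_sum_single a]
  exact Finset.sum_induction _ p add zero fun i _ => single i _

theorem hom_ext_single {M : Type*} [MulOneClass M] {F F' : Multiplicative (ι → ℤ) →* M}
    (h : ∀ i n, F (Multiplicative.ofAdd (Pi.single i n)) =
      F' (Multiplicative.ofAdd (Pi.single i n))) : F = F' := by
  refine DFunLike.ext _ _ fun a => ?_
  obtain ⟨a, rfl⟩ := Multiplicative.ofAdd.surjective a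
  induction a using int_pi_induction with
  | zero => simp
  | single i n => exact h i n
  | add a b ha hb => rw [ofAdd_add, map_mul, map_mul, ha, hb]

/-- Conjugation of monomials in a commuting family, when it multiplies each member of the family
by a power of a fixed element. -/
theorem conj_hom_eq_mul_zpow {X : ι → G} {F : Multiplicative (ι → ℤ) →* G}
    (hF : ∀ i n, F (Multiplicative.ofAdd (Pi.single i n)) = X i ^ n) {y z : G} {n : ι → ℤ}
    (h : ∀ i, y * X i * y⁻¹ = X i * z ^ n i) (hz : ∀ i, Commute z (X i)) (a : ι → ℤ) :
    y * F (Multiplicative.ofAdd a) * y⁻¹ = F (Multiplicative.ofAdd a) * z ^ (n ⬝ᵥ a) ∧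
      Commute z (F (Multiplicative.ofAdd a)) := by
  induction a using int_pi_induction with
  | zero => simp
  | single i k =>
    rw [hF, ← conj_zpow, h, ((hz i).symm.zpow_right _).mul_zpow, ← zpow_mul, dotProduct_single]
    exact ⟨rfl, (hz i).zpow_right k⟩
  | add a b ha hb =>
    rw [ofAdd_add, map_mul, dotProduct_add, zpow_add]
    refine ⟨?_, ha.2.mul_right hb.2⟩
    rw [← conj_mul, ha.1, hb.1, mul_assoc, ← mul_assoc (z ^ _), (hb.2.zpow_left _).eq]
    simp only [mul_assoc]

theorem conj_eq_mul_zpow_neg {x y z : G} {k : ℤ} (h : y * x * y⁻¹ = x * z ^ k)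
    (hx : Commute z x) (hy : Commute z y) : x * y * x⁻¹ = y * z ^ (-k) := by
  rw [mul_inv_eq_iff_eq_mul] at h ⊢
  rw [mul_assoc y, (hx.zpow_left _).eq, ← mul_assoc, h, mul_assoc x, (hy.zpow_left _).eq,
    mul_assoc, mul_assoc, ← zpow_add, add_neg_cancel, zpow_zero, mul_one]

/-- Commuting past each other two monomials in commuting families whose mutual commutators are
powers of a central element. -/
theorem hom_mul_hom_eq {X Y : ι → G} {FX FY : Multiplicative (ι → ℤ) →* G}
    (hFX : ∀ i n, FX (Multiplicative.ofAdd (Pi.single i n)) = X i ^ n)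
    (hFY : ∀ i n, FY (Multiplicative.ofAdd (Pi.single i n)) = Y i ^ n) {z : G}
    (hzX : ∀ i, Commute z (X i)) (hzY : ∀ i, Commute z (Y i)) {m : ι → ι → ℤ}
    (h : ∀ i j, Y j * X i * (Y j)⁻¹ = X i * z ^ m i j) (a b : ι → ℤ) :
    FY (Multiplicative.ofAdd b) * FX (Multiplicative.ofAdd a) =
      FX (Multiplicative.ofAdd a) * FY (Multiplicative.ofAdd b) *
        z ^ (∑ j, (∑ i, m i j * a i) * b j) := by
  have h1 := fun j => conj_hom_eq_mul_zpow hFX (fun i => h i j) hzX a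
  have h2 := (conj_hom_eq_mul_zpow hFX (y := 1) (n := 0) (by simp) hzX a).2
  have h3 := fun j => conj_eq_mul_zpow_neg (h1 j).1 h2 (hzY j)
  have h4 := conj_hom_eq_mul_zpow hFY h3 hzY b
  have h5 := conj_eq_mul_zpow_neg h4.1 h4.2 h2
  rw [mul_inv_eq_iff_eq_mul, mul_assoc, (h4.2.zpow_left _).eq, ← mul_assoc] at h5
  rw [h5]
  simp [dotProduct]

end FreeAbelian

/-- The Heisenberg group on the index set `ι`; the triple `(a, b, c)` stands for
`∏ xᵢ ^ aᵢ * ∏ yᵢ ^ bᵢ * z ^ c`. -/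
@[ext]
structure Heis (ι : Type*) where
  /-- The exponents of the `xᵢ`. -/
  a : ι → ℤ
  /-- The exponents of the `yᵢ`. -/
  b : ι → ℤ
  /-- The exponent of `z`. -/
  c : ℤ

namespace Heis

variable {ι : Type*}

instance : One (Heis ι) := ⟨⟨0, 0, 0⟩⟩

@[simp] theorem one_a : (1 : Heis ι).a = 0 := rfl
@[simp] theorem one_b : (1 : Heis ι).b = 0 := rfl
@[simp] theorem one_c : (1 : Heis ι).c = 0 := rfl

variable [Fintype ι]

instance : Mul (Heis ι) := ⟨fun g h => ⟨g.a + h.a, g.b + h.b, g.c + h.c - g.b ⬝ᵥ h.a⟩⟩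
instance : Inv (Heis ι) := ⟨fun g => ⟨-g.a, -g.b, -g.c - g.b ⬝ᵥ g.a⟩⟩

@[simp] theorem mul_a (g h : Heis ι) : (g * h).a = g.a + h.a := rfl
@[simp] theorem mul_b (g h : Heis ι) : (g * h).b = g.b + h.b := rfl
@[simp] theorem mul_c (g h : Heis ι) : (g * h).c = g.c + h.c - g.b ⬝ᵥ h.a := rfl
@[simp] theorem inv_a (g : Heis ι) : g⁻¹.a = -g.a := rfl
@[simp] theorem inv_b (g : Heis ι) : g⁻¹.b = -g.b := rfl
@[simp] theorem inv_c (g : Heis ι) : g⁻¹.c = -g.c - g.b ⬝ᵥ g.a := rfl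

instance : Group (Heis ι) :=
  Group.ofLeftAxioms
    (fun g h k => by
      ext
      · simp [add_assoc]
      · simp [add_assoc]
      · simp [add_dotProduct, dotProduct_add]
        ring)
    (fun g => by ext <;> simp)
    (fun g => by
      ext
      · simp
      · simp
      · simp [neg_dotProduct]
        ring)

/-- The sums of the exponents of the `xᵢ` and of the `yᵢ`. -/
def sumHom : Heis ι →* Multiplicative (ℤ × ℤ) where
  toFun g := Multiplicative.ofAdd (∑ i, g.a i, ∑ i, g.b i)
  map_one' := by simp [← Prod.zero_eq_mk]
  map_mul' g h := by
    rw [← ofAdd_add]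
    simp [Finset.sum_add_distrib]

theorem sumHom_eq_one {g : Heis ι} : sumHom g = 1 ↔ ∑ i, g.a i = 0 ∧ ∑ i, g.b i = 0 := by
  rw [← ofAdd_zero]
  exact Multiplicative.ofAdd.injective.eq_iff.trans Prod.ext_iff

/-- The embedding of the `x`-exponents. -/
def inA : Multiplicative (ι → ℤ) →* Heis ι where
  toFun a := ⟨a.toAdd, 0, 0⟩
  map_one' := rfl
  map_mul' a b := by ext <;> simp

/-- The embedding of the `y`-exponents. -/
def inB : Multiplicative (ι → ℤ) →* Heis ι where
  toFun a := ⟨0, a.toAdd, 0⟩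
  map_one' := rfl
  map_mul' a b := by ext <;> simp

/-- The embedding of the center. -/
def inC : Multiplicative ℤ →* Heis ι where
  toFun c := ⟨0, 0, c.toAdd⟩
  map_one' := rfl
  map_mul' a b := by ext <;> simp

section

variable [DecidableEq ι]

theorem inA_single_zpow (i : ι) (n : ℤ) :
    (⟨Pi.single i 1, 0, 0⟩ : Heis ι) ^ n = inA (Multiplicative.ofAdd (Pi.single i n)) := by
  change (inA (Multiplicative.ofAdd (Pi.single i 1))) ^ n = _
  rw [← map_zpow, ← ofAdd_zsmul, ← Pi.single_smul, smul_eq_mul, mul_one]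

theorem inB_single_zpow (i : ι) (n : ℤ) :
    (⟨0, Pi.single i 1, 0⟩ : Heis ι) ^ n = inB (Multiplicative.ofAdd (Pi.single i n)) := by
  change (inB (Multiplicative.ofAdd (Pi.single i 1))) ^ n = _
  rw [← map_zpow, ← ofAdd_zsmul, ← Pi.single_smul, smul_eq_mul, mul_one]

end

theorem inC_zpow (n : ℤ) : (⟨0, 0, 1⟩ : Heis ι) ^ n = inC (Multiplicative.ofAdd n) := by
  change (inC (Multiplicative.ofAdd 1)) ^ n = _
  rw [← map_zpow, ← ofAdd_zsmul, smul_eq_mul, mul_one]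

theorem inA_mul_inB_mul_inC (g : Heis ι) :
    inA (Multiplicative.ofAdd g.a) * inB (Multiplicative.ofAdd g.b) *
      inC (Multiplicative.ofAdd g.c) = g := by
  ext <;> simp [inA, inB, inC]

instance : MulDistribMulAction (Perm ι) (Heis ι) where
  smul σ g := ⟨g.a ∘ (σ⁻¹ : Perm ι), g.b ∘ (σ⁻¹ : Perm ι), g.c⟩
  one_smul g := rfl
  mul_smul σ τ g := rfl
  smul_mul σ g h := by
    ext
    · rfl
    · rfl
    · change _ - _ = _ - _
      congr 1
      exact (Equiv.sum_comp (σ⁻¹ : Perm ι) fun i => g.b i * h.a i).symm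
  smul_one σ := rfl

@[simp] theorem smul_a (σ : Perm ι) (g : Heis ι) : (σ • g).a = g.a ∘ (σ⁻¹ : Perm ι) := rfl
@[simp] theorem smul_b (σ : Perm ι) (g : Heis ι) : (σ • g).b = g.b ∘ (σ⁻¹ : Perm ι) := rfl
@[simp] theorem smul_c (σ : Perm ι) (g : Heis ι) : (σ • g).c = g.c := rfl

end Heis

section HeisHom

variable {ι G : Type*} [Fintype ι] [DecidableEq ι] [Group G]

/-- The normal form `g ↦ ∏ Xᵢ ^ g.aᵢ * ∏ Yᵢ ^ g.bᵢ * z ^ (-k * g.c)` is multiplicative on pairs of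
elements of the Heisenberg group for which the commutation relations match. -/
theorem heis_map_mul {X Y : ι → G} {FX FY : Multiplicative (ι → ℤ) →* G}
    (hFX : ∀ i n, FX (Multiplicative.ofAdd (Pi.single i n)) = X i ^ n)
    (hFY : ∀ i n, FY (Multiplicative.ofAdd (Pi.single i n)) = Y i ^ n) {z : G}
    (hzX : ∀ i, Commute z (X i)) (hzY : ∀ i, Commute z (Y i)) {m : ι → ι → ℤ}
    (h : ∀ i j, Y j * X i * (Y j)⁻¹ = X i * z ^ m i j) {k : ℤ} {g g' : Heis ι}
    (hk : ∑ j, (∑ i, m i j * g'.a i) * g.b j = k * (g.b ⬝ᵥ g'.a)) :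
    FX (.ofAdd (g * g').a) * FY (.ofAdd (g * g').b) * z ^ (-k * (g * g').c) =
      FX (.ofAdd g.a) * FY (.ofAdd g.b) * z ^ (-k * g.c) *
        (FX (.ofAdd g'.a) * FY (.ofAdd g'.b) * z ^ (-k * g'.c)) := by
  have key := hom_mul_hom_eq hFX hFY hzX hzY h g'.a g.b
  have e1 := (conj_hom_eq_mul_zpow hFX (y := 1) (n := 0) (by simp) hzX g'.a).2.zpow_left (-k * g.c)
  have e2 := (conj_hom_eq_mul_zpow hFY (y := 1) (n := 0) (by simp) hzY g'.b).2.zpow_left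
    (k * (g.b ⬝ᵥ g'.a) + -k * g.c)
  have hc : -k * (g * g').c = (k * (g.b ⬝ᵥ g'.a) + -k * g.c) + -k * g'.c := by
    rw [Heis.mul_c]
    ring
  rw [hk] at key
  rw [hc, Heis.mul_a, Heis.mul_b, ofAdd_add, map_mul, ofAdd_add, map_mul, zpow_add _ _ (-k * g'.c)]
  calc _ = FX (.ofAdd g.a) * (FX (.ofAdd g'.a) * FY (.ofAdd g.b)) *
        (FY (.ofAdd g'.b) * z ^ (k * (g.b ⬝ᵥ g'.a) + -k * g.c)) * z ^ (-k * g'.c) := by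
        simp only [mul_assoc]
    _ = FX (.ofAdd g.a) * (FY (.ofAdd g.b) * FX (.ofAdd g'.a)) *
        z ^ (-k * g.c) * FY (.ofAdd g'.b) * z ^ (-k * g'.c) := by
        rw [key, ← e2.eq, zpow_add]
        simp only [mul_assoc]
    _ = _ := by
      simp only [mul_assoc]
      rw [← mul_assoc (z ^ (-k * g.c)) (FX _), e1.eq]
      simp only [mul_assoc]

end HeisHom

section PresentationH

variable {ι : Type*} [Fintype ι] [DecidableEq ι]

/-- The images in the Heisenberg group of the generators of `H`. -/
def HGen.toHeis (ε : Fin 18 ≃ ι) : HGen → Heis ι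
  | .x i => ⟨Pi.single (ε i) 1, 0, 0⟩
  | .y i => ⟨0, Pi.single (ε i) 1, 0⟩
  | .z => ⟨0, 0, 1⟩

theorem HGen.lift_toHeis (ε : Fin 18 ≃ ι) :
    ∀ r ∈ HRels, FreeGroup.lift (HGen.toHeis ε) r = 1 := by
  rintro r (⟨i, j, h, rfl⟩ | ⟨i, j, h, rfl⟩ | ⟨i, j, h, rfl⟩ | ⟨i, rfl⟩ | ⟨i, rfl⟩ | ⟨i, rfl⟩) <;>
    ext <;> simp [fx, fy, fz, HGen.toHeis]
  simp [h]

/-- The homomorphism from `H` to the Heisenberg group. -/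
def toHeis (ε : Fin 18 ≃ ι) : Hgrp →* Heis ι :=
  PresentedGroup.toGroup (HGen.lift_toHeis ε)

theorem toHeis_x (ε : Fin 18 ≃ ι) (i) : toHeis ε (xH i) = ⟨Pi.single (ε i) 1, 0, 0⟩ :=
  PresentedGroup.toGroup.of _
theorem toHeis_y (ε : Fin 18 ≃ ι) (i) : toHeis ε (yH i) = ⟨0, Pi.single (ε i) 1, 0⟩ :=
  PresentedGroup.toGroup.of _
theorem toHeis_z (ε : Fin 18 ≃ ι) : toHeis ε zH = ⟨0, 0, 1⟩ :=
  PresentedGroup.toGroup.of _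

theorem xH_commute (i j : Fin 18) : Commute (xH i) (xH j) := by
  rcases eq_or_ne i j with rfl | h
  · rfl
  · exact PresentedGroup.mk_eq_mk_of_mul_inv_mem (rels := HRels) (x := fx i * fx j)
      (y := fx j * fx i) (Or.inl ⟨i, j, h, by group⟩)

theorem yH_commute (i j : Fin 18) : Commute (yH i) (yH j) := by
  rcases eq_or_ne i j with rfl | h
  · rfl
  · exact PresentedGroup.mk_eq_mk_of_mul_inv_mem (rels := HRels) (x := fy i * fy j)
      (y := fy j * fy i) (Or.inr (Or.inl ⟨i, j, h, by group⟩))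

theorem zH_commute_xH (i : Fin 18) : Commute zH (xH i) :=
  (PresentedGroup.mk_eq_mk_of_mul_inv_mem (rels := HRels) (x := fx i * fz) (y := fz * fx i)
      (Or.inr (Or.inr (Or.inr (Or.inr (Or.inl ⟨i, by group⟩)))))).symm

theorem zH_commute_yH (i : Fin 18) : Commute zH (yH i) :=
  (PresentedGroup.mk_eq_mk_of_mul_inv_mem (rels := HRels) (x := fy i * fz) (y := fz * fy i)
      (Or.inr (Or.inr (Or.inr (Or.inr (Or.inr ⟨i, by group⟩)))))).symm

theorem xH_yH_conj (i j : Fin 18) :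
    yH j * xH i * (yH j)⁻¹ = xH i * zH ^ (-(if i = j then 1 else 0 : ℤ)) := by
  split_ifs with h
  · subst h
    have h1 : xH i * yH i = zH * (yH i * xH i) :=
      PresentedGroup.mk_eq_mk_of_mul_inv_mem (rels := HRels) (x := fx i * fy i)
        (y := fz * (fy i * fx i)) (Or.inr (Or.inr (Or.inr (Or.inl ⟨i, by group⟩))))
    have h2 := (zH_commute_xH i).inv_left.eq
    rw [zpow_neg_one, ← h2, mul_inv_eq_iff_eq_mul, mul_assoc, h1, inv_mul_cancel_left]
  · have h1 : xH i * yH j = yH j * xH i :=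
      PresentedGroup.mk_eq_mk_of_mul_inv_mem (rels := HRels) (x := fx i * fy j) (y := fy j * fx i)
        (Or.inr (Or.inr (Or.inl ⟨i, j, h, by group⟩)))
    simp [← h1]

theorem toHeis_bijective (ε : Fin 18 ≃ ι) : Function.Bijective (toHeis ε) := by
  obtain ⟨FX, hFX⟩ := exists_hom_of_pairwise_commute (fun i => xH (ε.symm i))
    fun i j => xH_commute _ _
  obtain ⟨FY, hFY⟩ := exists_hom_of_pairwise_commute (fun i => yH (ε.symm i))
    fun i j => yH_commute _ _
  let N : Heis ι →* Hgrp := MonoidHom.mk'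
    (fun g => FX (.ofAdd g.a) * FY (.ofAdd g.b) * zH ^ (- -1 * g.c)) fun g g' =>
      heis_map_mul hFX hFY (fun i => zH_commute_xH _) (fun i => zH_commute_yH _)
        (fun i j => xH_yH_conj _ _) (by simp [dotProduct, mul_comm])
  have hNx : ∀ i, N (toHeis ε (xH i)) = xH i := fun i => by
    simp [toHeis_x, N, hFX]
  have hNy : ∀ i, N (toHeis ε (yH i)) = yH i := fun i => by
    simp [toHeis_y, N, hFY]
  have hNz : N (toHeis ε zH) = zH := by
    simp [toHeis_z, N]
  have hN : N.comp (toHeis ε) = MonoidHom.id _ := by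
    refine PresentedGroup.ext fun g => ?_
    rcases g with i | i | _
    · exact hNx i
    · exact hNy i
    · exact hNz
  refine ⟨Function.LeftInverse.injective (g := N) (DFunLike.congr_fun hN), fun g => ⟨N g, ?_⟩⟩
  have hA : (toHeis ε).comp FX = Heis.inA := hom_ext_single fun i n => by
    rw [MonoidHom.comp_apply, hFX, map_zpow, toHeis_x, Heis.inA_single_zpow]
    simp
  have hB : (toHeis ε).comp FY = Heis.inB := hom_ext_single fun i n => by
    rw [MonoidHom.comp_apply, hFY, map_zpow, toHeis_y, Heis.inB_single_zpow]
    simp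
  change toHeis ε (_ * _ * _) = _
  rw [neg_neg, one_mul, map_mul, map_mul, map_zpow, toHeis_z, ← MonoidHom.comp_apply, hA,
    ← MonoidHom.comp_apply, hB, Heis.inC_zpow, Heis.inA_mul_inB_mul_inC]

end PresentationH

/-- The semidirect product of the Heisenberg group on `ι` and the group of permutations of `ι`. -/
abbrev HeisPerm (ι : Type*) [Fintype ι] : Type _ :=
  Heis ι ⋊[MulDistribMulAction.toMulAut (Perm ι) (Heis ι)] Perm ι

section Reflections

variable {ι : Type*} [DecidableEq ι]

theorem single_comp_perm_inv (σ : Perm ι) (i : ι) (n : ℤ) :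
    (Pi.single i n : ι → ℤ) ∘ (σ⁻¹ : Perm ι) = Pi.single (σ i) n := by
  ext x
  simp [Pi.single_apply, Equiv.symm_apply_eq]

/-- The element `gᵢ * gⱼ⁻¹` of the Heisenberg group, where `gᵢ = xᵢ ^ v.1 * yᵢ ^ v.2`. -/
def Heis.diff (i j : ι) (v : ℤ × ℤ) : Heis ι :=
  ⟨Pi.single i v.1 - Pi.single j v.1, Pi.single i v.2 - Pi.single j v.2, -(v.1 * v.2)⟩

theorem Heis.diff_neg (i j : ι) (v : ℤ × ℤ) : Heis.diff j i (-v) = Heis.diff i j v := by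
  ext <;> simp [Heis.diff, Pi.single_neg] <;> ring

variable [Fintype ι]

theorem Heis.smul_diff (σ : Perm ι) (i j : ι) (v : ℤ × ℤ) :
    σ • Heis.diff i j v = Heis.diff (σ i) (σ j) v := by
  have h (i j : ι) (n : ℤ) : (Pi.single i n - Pi.single j n : ι → ℤ) ∘ (σ⁻¹ : Perm ι) =
      Pi.single (σ i) n - Pi.single (σ j) n := by
    rw [← single_comp_perm_inv, ← single_comp_perm_inv]
    rfl
  refine Heis.ext ?_ ?_ rfl <;> simp only [Heis.smul_a, Heis.smul_b, Heis.diff, h]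

/-- The conjugate of the transposition `(i j)` by `xᵢ ^ v.1 * yᵢ ^ v.2`. -/
def shiftedSwap (i j : ι) (v : ℤ × ℤ) : HeisPerm ι := ⟨Heis.diff i j v, swap i j⟩

theorem shiftedSwap_neg (i j : ι) (v : ℤ × ℤ) : shiftedSwap j i (-v) = shiftedSwap i j v := by
  rw [shiftedSwap, Heis.diff_neg, swap_comm, shiftedSwap]

theorem shiftedSwap_mul_self {i j : ι} (h : i ≠ j) (v : ℤ × ℤ) :
    shiftedSwap i j v * shiftedSwap i j v = 1 := by
  refine SemidirectProduct.ext ?_ (swap_mul_self i j)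
  change Heis.diff i j v * swap i j • Heis.diff i j v = 1
  rw [Heis.smul_diff]
  ext <;> simp [Heis.diff, h, h.symm]
  ring

theorem shiftedSwap_commute {i j k l : ι} (hik : i ≠ k) (hil : i ≠ l) (hjk : j ≠ k) (hjl : j ≠ l)
    (v w : ℤ × ℤ) : Commute (shiftedSwap i j v) (shiftedSwap k l w) := by
  refine SemidirectProduct.ext ?_ (Perm.Disjoint.commute ?_)
  · change Heis.diff i j v * swap i j • Heis.diff k l w =
      Heis.diff k l w * swap k l • Heis.diff i j v
    rw [Heis.smul_diff, Heis.smul_diff, swap_apply_of_ne_of_ne hik.symm hjk.symm,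
      swap_apply_of_ne_of_ne hil.symm hjl.symm, swap_apply_of_ne_of_ne hik hil,
      swap_apply_of_ne_of_ne hjk hjl]
    ext <;> simp [Heis.diff, hik, hil, hjk, hjl, hik.symm, hil.symm, hjk.symm,
      hjl.symm] <;> ring
  · intro x
    by_cases hi : x = i
    · subst hi; exact Or.inr (swap_apply_of_ne_of_ne hik hil)
    · by_cases hj : x = j
      · subst hj; exact Or.inr (swap_apply_of_ne_of_ne hjk hjl)
      · exact Or.inl (swap_apply_of_ne_of_ne hi hj)

theorem shiftedSwap_conj {i j k : ι} (hij : i ≠ j) (hjk : j ≠ k) (hik : i ≠ k) (v w : ℤ × ℤ) :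
    shiftedSwap i j v * shiftedSwap j k w * shiftedSwap i j v = shiftedSwap i k (v + w) := by
  refine SemidirectProduct.ext ?_ ?_
  · change Heis.diff i j v * swap i j • Heis.diff j k w * (swap i j * swap j k) • Heis.diff i j v =
      Heis.diff i k (v + w)
    rw [Heis.smul_diff, Heis.smul_diff, Perm.mul_apply, Perm.mul_apply, swap_apply_right,
      swap_apply_of_ne_of_ne hik.symm hjk.symm, swap_apply_of_ne_of_ne hij hik, swap_apply_left,
      swap_apply_left, swap_apply_of_ne_of_ne hik.symm hjk.symm]
    ext <;> simp [Heis.diff, Pi.single_add, hij, hjk, hij.symm,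
      hjk.symm, hik.symm] <;> ring
  · change swap i j * swap j k * swap i j = swap i k
    rw [swap_comm i j, swap_comm j k, swap_mul_swap_mul_swap hjk.symm hik.symm, swap_comm]

theorem shiftedSwap_conj_right {i j k : ι} (hij : i ≠ j) (hjk : j ≠ k) (hik : i ≠ k)
    (v w : ℤ × ℤ) :
    shiftedSwap j k w * shiftedSwap i j v * shiftedSwap j k w = shiftedSwap i k (v + w) := by
  rw [← shiftedSwap_neg, ← shiftedSwap_neg i j, shiftedSwap_conj hjk.symm hij.symm hik.symm,
    ← shiftedSwap_neg, neg_add_rev, neg_neg, neg_neg]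

theorem shiftedSwap_hexagon {a : Fin 6 → ι} (ha : Function.Injective a) {v : Fin 6 → ℤ × ℤ}
    (hv : v 0 + v 1 + v 2 + v 3 + v 4 + v 5 = 0) :
    shiftedSwap (a 0) (a 1) (v 0) * shiftedSwap (a 1) (a 2) (v 1) * shiftedSwap (a 2) (a 3) (v 2) *
        shiftedSwap (a 3) (a 4) (v 3) * shiftedSwap (a 4) (a 5) (v 4) =
      shiftedSwap (a 1) (a 2) (v 1) * shiftedSwap (a 2) (a 3) (v 2) *
        shiftedSwap (a 3) (a 4) (v 3) * shiftedSwap (a 4) (a 5) (v 4) *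
          shiftedSwap (a 5) (a 0) (v 5) := by
  have ne {i j : Fin 6} (h : i ≠ j) : a i ≠ a j := ha.ne h
  have h2 := shiftedSwap_conj_right (ne (show (0 : Fin 6) ≠ 1 by decide))
    (ne (show (1 : Fin 6) ≠ 2 by decide)) (ne (show (0 : Fin 6) ≠ 2 by decide)) (v 0) (v 1)
  have h3 := shiftedSwap_conj_right (ne (show (0 : Fin 6) ≠ 2 by decide))
    (ne (show (2 : Fin 6) ≠ 3 by decide)) (ne (show (0 : Fin 6) ≠ 3 by decide)) (v 0 + v 1) (v 2)
  have h4 := shiftedSwap_conj_right (ne (show (0 : Fin 6) ≠ 3 by decide))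
    (ne (show (3 : Fin 6) ≠ 4 by decide)) (ne (show (0 : Fin 6) ≠ 4 by decide))
    (v 0 + v 1 + v 2) (v 3)
  have h5 := shiftedSwap_conj_right (ne (show (0 : Fin 6) ≠ 4 by decide))
    (ne (show (4 : Fin 6) ≠ 5 by decide)) (ne (show (0 : Fin 6) ≠ 5 by decide))
    (v 0 + v 1 + v 2 + v 3) (v 4)
  rw [eq_neg_of_add_eq_zero_left hv, shiftedSwap_neg] at h5
  have sq {i j : Fin 6} (h : i ≠ j) (w) (x : HeisPerm ι) :
      shiftedSwap (a i) (a j) w * (shiftedSwap (a i) (a j) w * x) = x := by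
    rw [← mul_assoc, shiftedSwap_mul_self (ne h), one_mul]
  rw [← h5, ← h4, ← h3, ← h2]
  simp only [mul_assoc]
  rw [sq (by decide), sq (by decide), sq (by decide), sq (by decide)]

end Reflections

section Cocycles

variable {ι G : Type*} [Group G]

/-- A family of elements `X a b`, thought of as `xₐ * x_b⁻¹` for a commuting family `x`. -/
structure IsDiffFamily (X : ι → ι → G) : Prop where
  mul (a b c : ι) : X a b * X b c = X a c
  mul' (a b c : ι) : X b c * X a b = X a c

namespace IsDiffFamily

variable {X : ι → ι → G}

theorem self (hX : IsDiffFamily X) (a : ι) : X a a = 1 := by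
  simpa using hX.mul a a a

theorem inv (hX : IsDiffFamily X) (a b : ι) : (X a b)⁻¹ = X b a :=
  inv_eq_of_mul_eq_one_right ((hX.mul a b a).trans (hX.self a))

theorem commute (hX : IsDiffFamily X) (a b c d : ι) : Commute (X a b) (X c d) := by
  have h (a b c : ι) : Commute (X a b) (X b c) := (hX.mul a b c).trans (hX.mul' a b c).symm
  rw [← hX.mul c b d]
  exact ((hX.inv b c ▸ (h a b c).inv_right)).mul_right (h a b d)

end IsDiffFamily

/-- Two families of differences that commute when their indices are disjoint, and satisfy a
further relation for indices `a, c` in common. -/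
structure IsDiffPair (X Y : ι → ι → G) : Prop where
  left : IsDiffFamily X
  right : IsDiffFamily Y
  commute {a b c d : ι} : a ≠ c → a ≠ d → b ≠ c → b ≠ d → Commute (X a b) (Y c d)
  corner {a b c d : ι} : [a, b, c, d].Nodup →
    Y b c * X a c * Y a b = Y a d * X a c * Y d c
  fresh (l : List ι) (h : l.length ≤ 5) : ∃ x, x ∉ l

namespace IsDiffPair

variable {X Y : ι → ι → G}

theorem corner_self (h : IsDiffPair X Y) {a c d : ι} (hac : a ≠ c) (had : a ≠ d) (hcd : c ≠ d) :
    Y d c * X a c * (Y d c)⁻¹ = Y a d * X a c * (Y a d)⁻¹ := by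
  obtain ⟨b, hb⟩ := h.fresh [a, c, d] (by simp)
  obtain ⟨e, he⟩ := h.fresh [a, b, c, d] (by simp)
  simp only [List.mem_cons, List.not_mem_nil, or_false, not_or] at hb he
  have h1 := h.corner (a := a) (b := d) (c := c) (d := b) (by grind)
  have h2 := h.corner (a := a) (b := e) (c := c) (d := b) (by grind)
  have h3 := h.corner (a := a) (b := e) (c := c) (d := d) (by grind)
  have h4 := h1.trans (h2.symm.trans h3)
  have h5 := (h.right.commute a d d c).inv_left.eq
  calc _ = Y d c * X a c * Y a d * ((Y a d)⁻¹ * (Y d c)⁻¹) := by group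
    _ = Y a d * X a c * Y d c * ((Y d c)⁻¹ * (Y a d)⁻¹) := by
      rw [h4, ((h.right.commute a d d c).inv_inv).eq]
    _ = _ := by group

theorem comm_mul_left {p q y : G} (hp : Commute p y) :
    (p * q)⁻¹ * (y * (p * q) * y⁻¹) = q⁻¹ * (y * q * y⁻¹) := by
  rw [← mul_assoc y, ← hp.eq]
  group

theorem comm_congr_left (h : IsDiffPair X Y) {a c c' d : ι} (hac : a ≠ c) (hac' : a ≠ c')
    (hcd : c ≠ d) (hcd' : c' ≠ d) : (X a c)⁻¹ * (Y a d * X a c * (Y a d)⁻¹) =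
      (X a c')⁻¹ * (Y a d * X a c' * (Y a d)⁻¹) := by
  rw [← h.left.mul' a c' c, comm_mul_left (h.commute hac'.symm hcd' hac.symm hcd)]

theorem comm_congr_right (h : IsDiffPair X Y) {a c d d' : ι} (had : a ≠ d) (had' : a ≠ d')
    (hcd : c ≠ d) (hcd' : c ≠ d') : (X a c)⁻¹ * (Y a d * X a c * (Y a d)⁻¹) =
      (X a c)⁻¹ * (Y a d' * X a c * (Y a d')⁻¹) := by
  have hc := h.commute had' had hcd' hcd
  rw [← h.right.mul a d' d, mul_assoc (Y a d'), ← hc.eq]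
  group

theorem comm_congr (h : IsDiffPair X Y) {a c c' d d' : ι} (hac : a ≠ c) (had : a ≠ d) (hcd : c ≠ d)
    (hac' : a ≠ c') (had' : a ≠ d') (hcd' : c' ≠ d') : (X a c)⁻¹ * (Y a d * X a c * (Y a d)⁻¹) =
      (X a c')⁻¹ * (Y a d' * X a c' * (Y a d')⁻¹) := by
  obtain ⟨e, he⟩ := h.fresh [a, c, c', d, d'] (by simp)
  simp only [List.mem_cons, List.not_mem_nil, or_false, not_or] at he
  obtain ⟨hea, hec, hec', -, -⟩ := he
  rw [h.comm_congr_right had (Ne.symm hea) hcd (Ne.symm hec),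
    h.comm_congr_left hac hac' (Ne.symm hec) (Ne.symm hec'),
    h.comm_congr_right (Ne.symm hea) had' (Ne.symm hec') hcd']

theorem comm_eq (h : IsDiffPair X Y) {a a' c d : ι} (hac : a ≠ c) (had : a ≠ d) (hcd : c ≠ d)
    (hac' : a' ≠ c) (had' : a' ≠ d) : (X a c)⁻¹ * (Y a d * X a c * (Y a d)⁻¹) =
      (X a' c)⁻¹ * (Y d c * X a' c * (Y d c)⁻¹) := by
  rw [← h.corner_self hac had hcd, ← h.left.mul a a' c,
    comm_mul_left (h.commute had hac had' hac')]

theorem exists_center (h : IsDiffPair X Y) : ∃ z : G,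
    (∀ k l, Commute z (X k l)) ∧ (∀ k l, Commute z (Y k l)) ∧
    ∀ a c d, a ≠ c → a ≠ d → c ≠ d → Y a d * X a c * (Y a d)⁻¹ = X a c * z ∧
      Y d c * X a c * (Y d c)⁻¹ = X a c * z := by
  obtain ⟨o, -⟩ := h.fresh [] (by simp)
  obtain ⟨p, hp⟩ := h.fresh [o] (by simp)
  obtain ⟨q, hq⟩ := h.fresh [o, p] (by simp)
  simp only [List.mem_cons, List.not_mem_nil, or_false, not_or] at hp hq
  have main (a c d : ι) (hac : a ≠ c) (had : a ≠ d) (hcd : c ≠ d) :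
      (X a c)⁻¹ * (Y a d * X a c * (Y a d)⁻¹) = (X o p)⁻¹ * (Y o q * X o p * (Y o q)⁻¹) := by
    obtain ⟨e, he⟩ := h.fresh [a, o] (by simp)
    obtain ⟨f, hf⟩ := h.fresh [a, o, e] (by simp)
    simp only [List.mem_cons, List.not_mem_nil, or_false, not_or] at he hf
    rw [h.comm_congr hac had hcd (c' := e) (d' := f) (by grind) (by grind) (by grind),
      h.comm_eq (a' := o) (by grind) (by grind) (by grind) (by grind) (by grind),
      h.comm_congr (a := o) (c := p) (d := q) (c' := e) (d' := f) (by grind) (by grind) (by grind)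
        (by grind) (by grind) (by grind),
      h.comm_eq (a' := o) (by grind) (by grind) (by grind) (by grind) (by grind)]
  have central (k : ι) : Commute ((X o p)⁻¹ * (Y o q * X o p * (Y o q)⁻¹)) (X k o) ∧
      Commute ((X o p)⁻¹ * (Y o q * X o p * (Y o q)⁻¹)) (Y k o) := by
    obtain ⟨c, hc⟩ := h.fresh [k, o] (by simp)
    obtain ⟨d, hd⟩ := h.fresh [k, o, c] (by simp)
    obtain ⟨a, ha⟩ := h.fresh [k, o, c, d] (by simp)
    simp only [List.mem_cons, List.not_mem_nil, or_false, not_or] at hc hd ha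
    rw [← main o c d (by grind) (by grind) (by grind),
      h.comm_eq (a' := a) (by grind) (by grind) (by grind) (by grind) (by grind)]
    have h1 : Commute (X k o) (Y d c) := h.commute (by grind) (by grind) (by grind) (by grind)
    have h2 : Commute (X a c) (Y k o) := h.commute (by grind) (by grind) (by grind) (by grind)
    have h3 := h.left.commute a c k o
    have h4 := h.right.commute d c k o
    exact ⟨h3.inv_left.mul_left ((h1.symm.mul_left h3).mul_left h1.symm.inv_left),
      h2.inv_left.mul_left ((h4.mul_left h2).mul_left h4.inv_left)⟩
  refine ⟨(X o p)⁻¹ * (Y o q * X o p * (Y o q)⁻¹), fun k l => ?_, fun k l => ?_,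
    fun a c d hac had hcd => ?_⟩
  · rw [← h.left.mul k o l, ← h.left.inv l o]
    exact (central k).1.mul_right (central l).1.inv_right
  · rw [← h.right.mul k o l, ← h.right.inv l o]
    exact (central k).2.mul_right (central l).2.inv_right
  · rw [h.corner_self hac had hcd, ← main a c d hac had hcd, mul_inv_cancel_left]
    exact ⟨rfl, rfl⟩

end IsDiffPair

end Cocycles

section KernelOfProjection

variable {ι G : Type*} [Fintype ι] [DecidableEq ι] [Group G]

/-- If a group is generated by a normalized subgroup generated by `S` and a further subgroup,
then it is the product of the two. -/
theorem exists_mul_of_conj_mem {Q : Type*} [Group Q] {φ : Q →* G} {S : Set G}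
    (hS : ∀ σ, ∀ x ∈ S, φ σ * x * (φ σ)⁻¹ ∈ S)
    (gen : Subgroup.closure (S ∪ Set.range φ) = ⊤) (g : G) :
    ∃ n ∈ Subgroup.closure S, ∃ σ, g = n * φ σ := by
  have conj (σ : Q) : Subgroup.closure S ≤
      (Subgroup.closure S).comap (MulAut.conj (φ σ)).toMonoidHom :=
    (Subgroup.closure_le _).2 fun x hx => Subgroup.subset_closure (hS σ x hx)
  have hg : g ∈ Subgroup.closure (S ∪ Set.range φ) := gen ▸ Subgroup.mem_top g
  have left {x : G} (hx : x ∈ Subgroup.closure S) {y : G}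
      (hy : ∃ n ∈ Subgroup.closure S, ∃ σ, y = n * φ σ) :
      ∃ n ∈ Subgroup.closure S, ∃ σ, x * y = n * φ σ := by
    obtain ⟨n, hn, σ, rfl⟩ := hy
    exact ⟨x * n, mul_mem hx hn, σ, (mul_assoc _ _ _).symm⟩
  have right (τ : Q) {y : G} (hy : ∃ n ∈ Subgroup.closure S, ∃ σ, y = n * φ σ) :
      ∃ n ∈ Subgroup.closure S, ∃ σ, φ τ * y = n * φ σ := by
    obtain ⟨n, hn, σ, rfl⟩ := hy
    exact ⟨φ τ * n * (φ τ)⁻¹, conj τ hn, τ * σ, by simp [mul_assoc]⟩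
  induction hg using Subgroup.closure_induction_left with
  | one => exact ⟨1, one_mem _, 1, by simp⟩
  | mul_left x hx y _ ih =>
    rcases hx with hx | ⟨τ, rfl⟩
    · exact left (Subgroup.subset_closure hx) ih
    · exact right τ ih
  | inv_mul_cancel x hx y _ ih =>
    rcases hx with hx | ⟨τ, rfl⟩
    · exact left (inv_mem (Subgroup.subset_closure hx)) ih
    · exact map_inv φ τ ▸ right τ⁻¹ ih

namespace IsDiffPair

variable {X Y : ι → ι → G}

theorem exists_hom (h : IsDiffPair X Y) : ∃ Θ : (Heis.sumHom (ι := ι)).ker →* G,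
    (∀ a b, X a b ∈ Θ.range) ∧ (∀ a b, Y a b ∈ Θ.range) ∧
    ∀ P : G →* HeisPerm ι,
      (∀ a b, P (X a b) =
        SemidirectProduct.inl (Heis.inA (.ofAdd (Pi.single a 1 - Pi.single b 1)))) →
      (∀ a b, P (Y a b) =
        SemidirectProduct.inl (Heis.inB (.ofAdd (Pi.single a 1 - Pi.single b 1)))) →
      ∀ g, P (Θ g) = SemidirectProduct.inl g.1 := by
  obtain ⟨z, hzX, hzY, hz⟩ := h.exists_center
  obtain ⟨o, -⟩ := h.fresh [] (by simp)
  obtain ⟨FX, hFX⟩ := exists_hom_of_pairwise_commute (fun i => X i o)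
    fun i j => h.left.commute _ _ _ _
  obtain ⟨FY, hFY⟩ := exists_hom_of_pairwise_commute (fun i => Y i o)
    fun i j => h.right.commute _ _ _ _
  have hm (i j : ι) : Y j o * X i o * (Y j o)⁻¹ = X i o *
      z ^ (if j = o then 0 else if i = o then 0 else if i = j then 2 else 1 : ℤ) := by
    split_ifs with hj hi hij
    · simp [hj, h.right.self]
    · simp [hi, h.left.self]
    · subst hij
      obtain ⟨d, hd⟩ := h.fresh [i, o] (by simp)
      simp only [List.mem_cons, List.not_mem_nil, or_false, not_or] at hd
      obtain ⟨h1, h2⟩ := hz i o d hi (Ne.symm hd.1) (Ne.symm hd.2)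
      calc _ = Y i d * (Y d o * X i o * (Y d o)⁻¹) * (Y i d)⁻¹ := by
            rw [← h.right.mul i d o]
            group
        _ = (Y i d * X i o * (Y i d)⁻¹) * (Y i d * z * (Y i d)⁻¹) := by
            rw [h2]
            group
        _ = _ := by
            rw [h1, ← (hzY i d).eq, mul_inv_cancel_right, zpow_ofNat, pow_two, mul_assoc]
    · rw [zpow_one]
      exact (hz i o j hi hij (Ne.symm hj)).2
  have hsum {a b : ι → ℤ} (ha : ∑ i, a i = 0) (hb : ∑ i, b i = 0) :
      ∑ j, (∑ i, (if j = o then 0 else if i = o then 0 else if i = j then 2 else 1 : ℤ) * a i) * b j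
        = 1 * (b ⬝ᵥ a) := by
    have h1 (j : ι) : ∑ i, (if j = o then 0 else if i = o then 0 else if i = j then 2 else 1 : ℤ) *
        a i = a j - a o := by
      split_ifs with hj
      · simp [hj]
      · have h2 (i : ι) : (if i = o then 0 else if i = j then 2 else 1 : ℤ) * a i =
            a i + (if i = j then a i else 0) - (if i = o then a i else 0) := by
          split_ifs with h3 h4 <;> first | ring1 | skip
          exact absurd (h4.symm.trans h3) hj
        simp [h2, Finset.sum_add_distrib, ha]
    simp only [h1, sub_mul, Finset.sum_sub_distrib, ← Finset.mul_sum, hb]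
    simp [dotProduct, mul_comm]
  let Θ : (Heis.sumHom (ι := ι)).ker →* G := MonoidHom.mk'
    (fun g => FX (.ofAdd g.1.a) * FY (.ofAdd g.1.b) * z ^ (-1 * g.1.c)) fun g g' =>
      heis_map_mul hFX hFY (fun i => hzX _ _) (fun i => hzY _ _) hm
        (hsum (Heis.sumHom_eq_one.1 g'.2).1 (Heis.sumHom_eq_one.1 g.2).2)
  have hFX' (a b : ι) : FX (.ofAdd (Pi.single a 1 - Pi.single b 1)) = X a b := by
    rw [ofAdd_sub, map_div, hFX, hFX, zpow_one, zpow_one, div_eq_mul_inv, h.left.inv, h.left.mul]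
  have hFY' (a b : ι) : FY (.ofAdd (Pi.single a 1 - Pi.single b 1)) = Y a b := by
    rw [ofAdd_sub, map_div, hFY, hFY, zpow_one, zpow_one, div_eq_mul_inv, h.right.inv, h.right.mul]
  refine ⟨Θ, fun a b => ⟨⟨Heis.inA (.ofAdd (Pi.single a 1 - Pi.single b 1)),
    Heis.sumHom_eq_one.2 ?_⟩, ?_⟩, fun a b => ⟨⟨Heis.inB (.ofAdd (Pi.single a 1 - Pi.single b 1)),
    Heis.sumHom_eq_one.2 ?_⟩, ?_⟩, fun P hPX hPY g => ?_⟩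
  · simp [Heis.inA]
  · simpa [Θ, Heis.inA] using hFX' a b
  · simp [Heis.inB]
  · simpa [Θ, Heis.inB] using hFY' a b
  · have hPFX (a : ι → ℤ) : P (FX (.ofAdd a)) = SemidirectProduct.inl
        (Heis.inA (.ofAdd (a - Pi.single o (∑ i, a i)))) := by
      induction a using int_pi_induction with
      | zero => simp
      | single i n =>
        rw [hFX, map_zpow, hPX, ← map_zpow, ← map_zpow, ← ofAdd_zsmul]
        simp [smul_sub, ← Pi.single_smul]
      | add a b ha hb =>
        rw [ofAdd_add, map_mul, map_mul, ha, hb, ← map_mul, ← map_mul, ← ofAdd_add]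
        simp [Finset.sum_add_distrib, Pi.single_add, add_sub_add_comm]
    have hPFY (a : ι → ℤ) : P (FY (.ofAdd a)) = SemidirectProduct.inl
        (Heis.inB (.ofAdd (a - Pi.single o (∑ i, a i)))) := by
      induction a using int_pi_induction with
      | zero => simp
      | single i n =>
        rw [hFY, map_zpow, hPY, ← map_zpow, ← map_zpow, ← ofAdd_zsmul]
        simp [smul_sub, ← Pi.single_smul]
      | add a b ha hb =>
        rw [ofAdd_add, map_mul, map_mul, ha, hb, ← map_mul, ← map_mul, ← ofAdd_add]
        simp [Finset.sum_add_distrib, Pi.single_add, add_sub_add_comm]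
    have hPz : P z = SemidirectProduct.inl (Heis.inC (.ofAdd (-1))) := by
      obtain ⟨c, hc⟩ := h.fresh [o] (by simp)
      obtain ⟨d, hd⟩ := h.fresh [o, c] (by simp)
      simp only [List.mem_cons, List.not_mem_nil, or_false, not_or] at hc hd
      have h1 := (hz o c d (Ne.symm hc) (Ne.symm hd.1) (Ne.symm hd.2)).1
      rw [← inv_mul_eq_iff_eq_mul] at h1
      rw [← h1, map_mul, map_mul, map_mul, map_inv, map_inv, hPX, hPY]
      simp only [← map_inv SemidirectProduct.inl, ← map_mul SemidirectProduct.inl]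
      congr 1
      ext <;> simp [Heis.inA, Heis.inB, Heis.inC, hc, Ne.symm hd.1, Ne.symm hd.2]
    obtain ⟨h1, h2⟩ := Heis.sumHom_eq_one.1 g.2
    change P (_ * _ * _) = _
    rw [map_mul, map_mul, map_zpow, hPFX, hPFY, hPz, h1, h2, ← map_mul, ← map_zpow, ← map_mul,
      ← map_zpow, ← ofAdd_zsmul]
    simp [Heis.inA_mul_inB_mul_inC]

/-- The kernel of the projection to the permutation group, for a group which is generated by
permutations and an equivariant pair of families of differences. -/
theorem nonempty_ker_mulEquiv (h : IsDiffPair X Y) {φ : Perm ι →* G}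
    (hX : ∀ σ a b, φ σ * X a b * (φ σ)⁻¹ = X (σ a) (σ b))
    (hY : ∀ σ a b, φ σ * Y a b * (φ σ)⁻¹ = Y (σ a) (σ b))
    (gen : Subgroup.closure (Set.range (Function.uncurry X) ∪ Set.range (Function.uncurry Y) ∪
      Set.range φ) = ⊤)
    (P : G →* HeisPerm ι) (hφ : ∀ σ, P (φ σ) = SemidirectProduct.inr σ)
    (hPX : ∀ a b, P (X a b) =
      SemidirectProduct.inl (Heis.inA (.ofAdd (Pi.single a 1 - Pi.single b 1))))
    (hPY : ∀ a b, P (Y a b) =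
      SemidirectProduct.inl (Heis.inB (.ofAdd (Pi.single a 1 - Pi.single b 1)))) :
    Nonempty ((SemidirectProduct.rightHom.comp P).ker ≃* (Heis.sumHom (ι := ι)).ker) := by
  obtain ⟨Θ, hΘX, hΘY, hPΘ⟩ := h.exists_hom
  replace hPΘ := hPΘ P hPX hPY
  have hker (g) : Θ g ∈ (SemidirectProduct.rightHom.comp P).ker := by
    simp [MonoidHom.mem_ker, hPΘ]
  refine ⟨(MulEquiv.ofBijective (Θ.codRestrict _ hker) ⟨fun g g' hg => ?_, fun g => ?_⟩).symm⟩
  · have := congrArg P (congrArg Subtype.val hg)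
    simp only [MonoidHom.codRestrict_apply, hPΘ] at this
    exact Subtype.ext (SemidirectProduct.inl_injective this)
  · obtain ⟨n, hn, σ, hg⟩ := exists_mul_of_conj_mem (φ := φ) (by
      rintro σ _ (⟨⟨a, b⟩, rfl⟩ | ⟨⟨a, b⟩, rfl⟩)
      · exact Or.inl ⟨(σ a, σ b), (hX σ a b).symm⟩
      · exact Or.inr ⟨(σ a, σ b), (hY σ a b).symm⟩) gen g.1
    have hle : Subgroup.closure (Set.range (Function.uncurry X) ∪ Set.range (Function.uncurry Y)) ≤
        Θ.range := by
      rw [Subgroup.closure_le]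
      rintro _ (⟨⟨a, b⟩, rfl⟩ | ⟨⟨a, b⟩, rfl⟩)
      · exact hΘX a b
      · exact hΘY a b
    obtain ⟨k, rfl⟩ := hle hn
    refine ⟨k, Subtype.ext ?_⟩
    have h1 := MonoidHom.mem_ker.1 g.2
    rw [hg, map_mul, MonoidHom.mem_ker.1 (hker k), one_mul, MonoidHom.comp_apply, hφ,
      SemidirectProduct.rightHom_inr] at h1
    rw [hg, h1, map_one, mul_one]
    rfl

end IsDiffPair

end KernelOfProjection

section ReflectionFamilies

variable {ι G : Type*} [DecidableEq ι] [Group G] {φ : Perm ι →* G}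

/-- A family of involutions `U a b`, equivariant under permutations, thought of as the conjugate
of the transposition `(a b)` by an element `xₐ` of a commuting family. -/
structure IsReflFamily (φ : Perm ι →* G) (U : ι → ι → G) : Prop where
  conj (σ : Perm ι) (a b : ι) : φ σ * U a b * (φ σ)⁻¹ = U (σ a) (σ b)
  self (a : ι) : U a a = 1
  mul_self (a b : ι) : U a b * U a b = 1
  conj_left {a b c : ι} : a ≠ b → a ≠ c → b ≠ c → U a b * φ (swap b c) * U a b = U a c
  conj_right {a b c : ι} : a ≠ b → a ≠ c → b ≠ c → U a b * φ (swap a c) * U a b = U c b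

namespace IsReflFamily

theorem mul_eq {U : ι → ι → G} (h : IsReflFamily φ U) (σ : Perm ι) (a b : ι) :
    φ σ * U a b = U (σ a) (σ b) * φ σ := by
  rw [← h.conj, inv_mul_cancel_right]

theorem mul_mul_eq {U : ι → ι → G} (h : IsReflFamily φ U) (σ : Perm ι) (a b : ι) (g : G) :
    φ σ * (U a b * g) = U (σ a) (σ b) * (φ σ * g) := by
  rw [← mul_assoc, h.mul_eq, mul_assoc]

theorem isDiffFamily {U : ι → ι → G} (h : IsReflFamily φ U) :
    IsDiffFamily fun a b => U a b * φ (swap a b) := by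
  have key {a b c : ι} (hab : a ≠ b) (hac : a ≠ c) (hbc : b ≠ c) :
      U a b * φ (swap a b) * (U b c * φ (swap b c)) = U a c * φ (swap a c) ∧
      U b c * φ (swap b c) * (U a b * φ (swap a b)) = U a c * φ (swap a c) := by
    have h1 : U a b * U a c = U a c * φ (swap b c) := by
      rw [← h.conj_left hab hac hbc, ← mul_assoc, ← mul_assoc, h.mul_self, one_mul, h.mul_eq,
        swap_apply_of_ne_of_ne hab hac, swap_apply_left, ← h.conj_left hab hac hbc]
    have h2 : U b c * U a c = U a c * φ (swap b a) := by
      rw [← h.conj_right hbc hab.symm hac.symm, ← mul_assoc, ← mul_assoc, h.mul_self, one_mul,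
        h.mul_eq, swap_apply_of_ne_of_ne hbc.symm hac.symm, swap_apply_left,
        ← h.conj_right hbc hab.symm hac.symm]
    constructor
    · rw [mul_assoc, h.mul_mul_eq, swap_apply_right, swap_apply_of_ne_of_ne hac.symm hbc.symm,
        ← mul_assoc, h1, mul_assoc, ← map_mul, ← map_mul, ← mul_assoc,
        swap_mul_swap_mul_swap hab hac, swap_comm]
    · rw [mul_assoc, h.mul_mul_eq, swap_apply_left, swap_apply_of_ne_of_ne hab hac, ← mul_assoc, h2,
        mul_assoc, ← map_mul, ← map_mul, ← mul_assoc, swap_comm b c, swap_comm a b,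
        swap_mul_swap_mul_swap hbc.symm hac.symm]
  have self (a : ι) : U a a * φ (swap a a) = 1 := by
    rw [h.self, swap_self, one_mul]
    exact map_one φ
  have inv (a b : ι) : U a b * φ (swap a b) * (U b a * φ (swap b a)) = 1 := by
    rw [mul_assoc, h.mul_mul_eq, swap_apply_left, swap_apply_right, ← mul_assoc, h.mul_self,
      swap_comm b a, ← map_mul, swap_mul_self, map_one, one_mul]
  have main (a b c : ι) :
      U a b * φ (swap a b) * (U b c * φ (swap b c)) = U a c * φ (swap a c) ∧
      U b c * φ (swap b c) * (U a b * φ (swap a b)) = U a c * φ (swap a c) := by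
    by_cases hab : a = b
    · simp only [hab, self, one_mul, mul_one, and_self]
    by_cases hbc : b = c
    · simp only [hbc, self, one_mul, mul_one, and_self]
    by_cases hac : a = c
    · simp only [hac, self, inv, and_self]
    exact key hab hac hbc
  exact ⟨fun a b c => (main a b c).1, fun a b c => (main a b c).2⟩

theorem corner_of_conj_eq {U V : ι → ι → G} (hU : IsReflFamily φ U) (hV : IsReflFamily φ V)
    {a b c d : ι} (hn : [a, b, c, d].Nodup)
    (h : V b c * U a b * V b c = V a d * U d c * V a d) :
    V b c * φ (swap b c) * (U a c * φ (swap a c)) * (V a b * φ (swap a b)) =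
      V a d * φ (swap a d) * (U a c * φ (swap a c)) * (V d c * φ (swap d c)) := by
  simp only [List.nodup_cons, List.mem_cons, List.not_mem_nil, or_false, not_or] at hn
  have e {b : ι} (hba : b ≠ a) (hbc : b ≠ c) :
      swap b c * (swap a c * swap a b) = swap a c := by
    ext x
    simp only [Perm.mul_apply, swap_apply_def]
    grind
  have e' {d : ι} (hda : d ≠ a) (hdc : d ≠ c) :
      swap a d * (swap a c * swap d c) = swap a c := by
    ext x
    simp only [Perm.mul_apply, swap_apply_def]
    grind
  have h1 : swap b c a = a := swap_apply_of_ne_of_ne (by grind) (by grind)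
  have h2 : swap a c b = b := swap_apply_of_ne_of_ne (by grind) (by grind)
  have h3 : swap a d c = c := swap_apply_of_ne_of_ne (by grind) (by grind)
  have h4 : swap a c d = d := swap_apply_of_ne_of_ne (by grind) (by grind)
  simp only [mul_assoc, hU.mul_mul_eq, hV.mul_mul_eq, swap_apply_left, swap_apply_right, h1, h2,
    h3, h4]
  rw [← map_mul, ← map_mul, ← map_mul, ← map_mul, e (by grind) (by grind), e' (by grind) (by grind),
    ← mul_assoc, ← mul_assoc, h, mul_assoc, mul_assoc]

end IsReflFamily

theorem Equiv.Perm.mem_of_swap_mem {S : Subgroup (Perm ι)} [Fintype ι] {p : ι → Prop}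
    [DecidablePred p]
    (h : ∀ a b, p a → p b → swap a b ∈ S) {σ : Perm ι} (hσ : ∀ x, ¬ p x → σ x = x) : σ ∈ S := by
  have h1 (x) : p (σ x) ↔ p x := by
    refine ⟨fun hx => by_contra fun hp => hp (hσ x hp ▸ hx), fun hx => by_contra fun hp => hp ?_⟩
    have := σ.injective (hσ _ hp)
    rwa [this]
  rw [← Perm.ofSubtype_subtypePerm h1 fun x hx => by_contra fun hp => hx (hσ x hp)]
  induction σ.subtypePerm h1 using Perm.swap_induction_on with
  | one => simp
  | swap_mul f x y _ ih =>
    rw [map_mul, Perm.ofSubtype_swap_eq]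
    exact mul_mem (h _ _ x.2 y.2) ih

theorem Equiv.swap_mem_of_isChain {S : Subgroup (Perm ι)} {l : List ι} {a : ι}
    (h : List.IsChain (fun x y => swap x y ∈ S) (a :: l)) : ∀ b ∈ a :: l, swap a b ∈ S := by
  induction l generalizing a with
  | nil =>
    intro b hb
    rw [List.mem_singleton.1 hb, swap_self]
    exact one_mem S
  | cons c l ih =>
    rw [List.isChain_cons_cons] at h
    intro b hb
    rcases List.mem_cons.1 hb with rfl | hb
    · rw [swap_self]
      exact one_mem S
    · exact SubmonoidClass.swap_mem_trans S h.1 (ih h.2 b hb)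

/-- An element which commutes with all permutations that fix two points extends to an equivariant
family indexed by pairs of points. -/
theorem exists_equivariant_family {i j : ι} (hij : i ≠ j) {u : G}
    (hu : ∀ σ : Perm ι, σ i = i → σ j = j → Commute (φ σ) u) :
    ∃ U : ι → ι → G, U i j = u ∧ (∀ a, U a a = 1) ∧
      ∀ (σ : Perm ι) a b, φ σ * U a b * (φ σ)⁻¹ = U (σ a) (σ b) := by
  have hex (a b : ι) : ∃ σ : Perm ι, a ≠ b → σ i = a ∧ σ j = b := by
    by_cases h : a = b
    · exact ⟨1, fun h' => absurd h h'⟩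
    · obtain ⟨σ, hσ⟩ := Perm.exists_extending_pair ![i, j] ![a, b]
        (by simpa [Function.Injective, Fin.forall_fin_two] using ⟨hij, hij.symm⟩)
        (by simpa [Function.Injective, Fin.forall_fin_two] using ⟨h, Ne.symm h⟩)
      exact ⟨σ, fun _ => ⟨hσ 0, hσ 1⟩⟩
  choose s hs using hex
  have hconj {σ τ : Perm ι} (h1 : σ i = τ i) (h2 : σ j = τ j) :
      φ σ * u * (φ σ)⁻¹ = φ τ * u * (φ τ)⁻¹ := by
    have := (hu (τ⁻¹ * σ) (by simp [h1]) (by simp [h2])).eq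
    calc φ σ * u * (φ σ)⁻¹ = φ τ * (φ (τ⁻¹ * σ) * u) * (φ σ)⁻¹ := by simp [mul_assoc]
      _ = _ := by
        rw [this]
        simp [mul_assoc]
  refine ⟨fun a b => if a = b then 1 else φ (s a b) * u * (φ (s a b))⁻¹, ?_, fun a => if_pos rfl,
    fun σ a b => ?_⟩
  · simp only [if_neg hij]
    rw [hconj (τ := 1) (hs i j hij).1 (hs i j hij).2]
    simp
  · by_cases h : a = b
    · simp [h]
    · have h' : σ a ≠ σ b := σ.injective.ne h
      simp only [if_neg h, if_neg h']
      rw [hconj (σ := s (σ a) (σ b)) (τ := σ * s a b)]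
      · simp [mul_assoc]
      · simp [(hs _ _ h').1, (hs _ _ h).1]
      · simp [(hs _ _ h').2, (hs _ _ h).2]

end ReflectionFamilies

section ReflectionPairs

section

variable {ι : Type*}

theorem exists_perm_of_nodup_two [Finite ι] {a b a' b' : ι} (h : [a, b].Nodup)
    (h' : [a', b'].Nodup) : ∃ σ : Perm ι, σ a = a' ∧ σ b = b' := by
  obtain ⟨σ, hσ⟩ := Perm.exists_extending_pair (α := Fin 2) [a, b].get [a', b'].get
    (List.nodup_iff_injective_get.1 h) (List.nodup_iff_injective_get.1 h')
  exact ⟨σ, hσ 0, hσ 1⟩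

theorem exists_perm_of_nodup_three [Finite ι] {a b c a' b' c' : ι} (h : [a, b, c].Nodup)
    (h' : [a', b', c'].Nodup) : ∃ σ : Perm ι, σ a = a' ∧ σ b = b' ∧ σ c = c' := by
  obtain ⟨σ, hσ⟩ := Perm.exists_extending_pair (α := Fin 3) [a, b, c].get [a', b', c'].get
    (List.nodup_iff_injective_get.1 h) (List.nodup_iff_injective_get.1 h')
  exact ⟨σ, hσ 0, hσ 1, hσ 2⟩

theorem exists_perm_of_nodup_four [Finite ι] {a b c d a' b' c' d' : ι} (h : [a, b, c, d].Nodup)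
    (h' : [a', b', c', d'].Nodup) : ∃ σ : Perm ι, σ a = a' ∧ σ b = b' ∧ σ c = c' ∧ σ d = d' := by
  obtain ⟨σ, hσ⟩ := Perm.exists_extending_pair (α := Fin 4) [a, b, c, d].get [a', b', c', d'].get
    (List.nodup_iff_injective_get.1 h) (List.nodup_iff_injective_get.1 h')
  exact ⟨σ, hσ 0, hσ 1, hσ 2, hσ 3⟩

end

variable {ι G : Type*} [DecidableEq ι] [Group G] {φ : Perm ι →* G}

/-- An involution `u` which commutes with all permutations that fix `i` and `j`, and satisfies
braid relations with a transposition moving `i` and with one moving `j`, extends to a family. -/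
theorem exists_isReflFamily [Finite ι] {i j k l : ι} (hij : i ≠ j) (hik : i ≠ k) (hjk : j ≠ k)
    (hil : i ≠ l) (hjl : j ≠ l) {u : G}
    (hu : ∀ σ : Perm ι, σ i = i → σ j = j → Commute (φ σ) u) (sq : u * u = 1)
    (left : u * φ (swap j k) * u = φ (swap j k) * u * φ (swap j k))
    (right : u * φ (swap i l) * u = φ (swap i l) * u * φ (swap i l)) :
    ∃ U, IsReflFamily φ U ∧ U i j = u := by
  obtain ⟨U, rfl, self, conj⟩ := exists_equivariant_family hij hu
  have inv (a b : ι) : (φ (swap a b))⁻¹ = φ (swap a b) := by rw [← map_inv, swap_inv]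
  refine ⟨U, ⟨conj, self, fun a b => ?_, fun {a b c} hab hac hbc => ?_,
    fun {a b c} hab hac hbc => ?_⟩, rfl⟩
  · by_cases hab : a = b
    · simp [hab, self]
    · obtain ⟨σ, rfl, rfl⟩ := exists_perm_of_nodup_two (a := i) (b := j) (a' := a) (b' := b)
        (by simpa using hij) (by simpa using hab)
      rw [← conj]
      calc _ = φ σ * (U i j * U i j) * (φ σ)⁻¹ := by group
        _ = 1 := by rw [sq, mul_one, mul_inv_cancel]
  · obtain ⟨σ, rfl, rfl, rfl⟩ := exists_perm_of_nodup_three (a := i) (b := j) (c := k)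
      (a' := a) (b' := b) (c' := c) (by simp; grind) (by simp; grind)
    have h : φ (swap (σ j) (σ k)) = φ σ * φ (swap j k) * (φ σ)⁻¹ := by
      rw [← map_inv, ← map_mul, ← map_mul, ← Equiv.swap_apply_apply]
    have h' : U i k = U i j * φ (swap j k) * U i j := by
      rw [left]
      nth_rw 2 [← inv]
      rw [conj, swap_apply_left, swap_apply_of_ne_of_ne hij hik]
    rw [← conj σ i j, ← conj σ i k, h, h']
    group
  · obtain ⟨σ, rfl, rfl, rfl⟩ := exists_perm_of_nodup_three (a := i) (b := j) (c := l)
      (a' := a) (b' := b) (c' := c) (by simp; grind) (by simp; grind)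
    have h : φ (swap (σ i) (σ l)) = φ σ * φ (swap i l) * (φ σ)⁻¹ := by
      rw [← map_inv, ← map_mul, ← map_mul, ← Equiv.swap_apply_apply]
    have h' : U l j = U i j * φ (swap i l) * U i j := by
      rw [right]
      nth_rw 2 [← inv]
      rw [conj, swap_apply_left, swap_apply_of_ne_of_ne hij.symm hjl]
    rw [← conj σ i j, ← conj σ l j, h, h']
    group

theorem inr_mul_shiftedSwap_mul_inv [Fintype ι] (σ : Perm ι) (i j : ι) (v : ℤ × ℤ) :
    SemidirectProduct.inr σ * shiftedSwap i j v * (SemidirectProduct.inr σ)⁻¹ =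
      shiftedSwap (σ i) (σ j) v := by
  rw [mul_inv_eq_iff_eq_mul]
  refine SemidirectProduct.ext ?_ ?_
  · simp only [SemidirectProduct.mul_left, SemidirectProduct.left_inr, SemidirectProduct.right_inr,
      map_one, mul_one, one_mul]
    exact Heis.smul_diff σ i j v
  · simp [shiftedSwap, swap_apply_apply]

theorem shiftedSwap_mul_inr [Fintype ι] (i j : ι) (v : ℤ × ℤ) :
    shiftedSwap i j v * SemidirectProduct.inr (swap i j) =
      SemidirectProduct.inl (Heis.diff i j v) := by
  refine SemidirectProduct.ext ?_ (swap_mul_self i j)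
  simp [shiftedSwap]

namespace IsReflFamily

variable {U V : ι → ι → G}

theorem isDiffPair [Finite ι] (hU : IsReflFamily φ U) (hV : IsReflFamily φ V)
    (fresh : ∀ l : List ι, l.length ≤ 5 → ∃ x, x ∉ l)
    {i j k l : ι} (hn : [i, j, k, l].Nodup) (comm : Commute (U i j) (V k l))
    {a b c d : ι} (hn' : [a, b, c, d].Nodup)
    (corner : V b c * U a b * V b c = V a d * U d c * V a d) :
    IsDiffPair (fun a b => U a b * φ (swap a b)) fun a b => V a b * φ (swap a b) where
  left := hU.isDiffFamily
  right := hV.isDiffFamily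
  commute := by
    intro p q r s hpr hps hqr hqs
    by_cases hpq : p = q
    · rw [hpq, hU.isDiffFamily.self q]
      exact Commute.one_left _
    by_cases hrs : r = s
    · rw [hrs, hV.isDiffFamily.self s]
      exact Commute.one_right _
    obtain ⟨σ, rfl, rfl, rfl, rfl⟩ := exists_perm_of_nodup_four hn (a' := p) (b' := q) (c' := r)
      (d' := s) (by simp; grind)
    have h1 : Commute (U (σ i) (σ j)) (V (σ k) (σ l)) := by
      rw [← hU.conj, ← hV.conj]
      exact (Commute.conj_iff _).2 comm
    have h2 : Commute (φ (swap (σ i) (σ j))) (V (σ k) (σ l)) := by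
      rw [Commute, SemiconjBy, hV.mul_eq, swap_apply_of_ne_of_ne hpr.symm hqr.symm,
        swap_apply_of_ne_of_ne hps.symm hqs.symm]
    have h3 : Commute (φ (swap (σ k) (σ l))) (U (σ i) (σ j)) := by
      rw [Commute, SemiconjBy, hU.mul_eq, swap_apply_of_ne_of_ne hpr hps,
        swap_apply_of_ne_of_ne hqr hqs]
    have h4 : Commute (φ (swap (σ i) (σ j))) (φ (swap (σ k) (σ l))) := by
      rw [Commute, SemiconjBy, ← map_mul, ← map_mul,
        (Perm.disjoint_swap_swap (by simp; grind)).commute.eq]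
    exact (h1.mul_right h3.symm).mul_left (h2.mul_right h4)
  corner := by
    intro p q r s h
    obtain ⟨σ, rfl, rfl, rfl, rfl⟩ := exists_perm_of_nodup_four hn' h
    refine corner_of_conj_eq hU hV h ?_
    simp only [← hU.conj, ← hV.conj]
    have := congrArg (fun g => φ σ * g * (φ σ)⁻¹) corner
    simpa only [mul_assoc, inv_mul_cancel_left] using this
  fresh := fresh

theorem map_mul_swap [Fintype ι] (hU : IsReflFamily φ U) {P : G →* HeisPerm ι}
    (hφ : ∀ σ, P (φ σ) = SemidirectProduct.inr σ) {i j : ι} (hij : i ≠ j) {v : ℤ × ℤ}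
    (hv : v.1 * v.2 = 0) (h : P (U i j) = shiftedSwap i j v) (a b : ι) :
    P (U a b * φ (swap a b)) = SemidirectProduct.inl (Heis.diff a b v) := by
  by_cases hab : a = b
  · rw [hab, hU.isDiffFamily.self b, map_one]
    refine SemidirectProduct.ext ?_ rfl
    ext <;> simp [Heis.diff, hv]
  · obtain ⟨σ, rfl, rfl⟩ := exists_perm_of_nodup_two (a := i) (b := j) (a' := a) (b' := b)
      (by simpa using hij) (by simpa using hab)
    rw [map_mul, hφ, ← hU.conj, map_mul, map_mul, map_inv, h, hφ, inr_mul_shiftedSwap_mul_inv,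
      shiftedSwap_mul_inr]

/-- The kernel of the projection to the permutation group, for a group which is generated by
permutations and a pair of families of reflections. -/
theorem nonempty_ker_mulEquiv [Fintype ι] (hU : IsReflFamily φ U) (hV : IsReflFamily φ V)
    (h : IsDiffPair (fun a b => U a b * φ (swap a b)) fun a b => V a b * φ (swap a b))
    (gen : ∀ S : Subgroup G, (∀ σ, φ σ ∈ S) → (∀ a b, U a b ∈ S) → (∀ a b, V a b ∈ S) → S = ⊤)
    {P : G →* HeisPerm ι} (hφ : ∀ σ, P (φ σ) = SemidirectProduct.inr σ) {i j k l : ι}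
    (hij : i ≠ j) (hPU : P (U i j) = shiftedSwap i j (1, 0))
    (hkl : k ≠ l) (hPV : P (V k l) = shiftedSwap k l (0, 1)) :
    Nonempty ((SemidirectProduct.rightHom.comp P).ker ≃* (Heis.sumHom (ι := ι)).ker) := by
  have equivariant {W : ι → ι → G} (hW : IsReflFamily φ W) (σ : Perm ι) (a b : ι) :
      φ σ * (W a b * φ (swap a b)) * (φ σ)⁻¹ = W (σ a) (σ b) * φ (swap (σ a) (σ b)) := by
    rw [swap_apply_apply, map_mul, map_mul, map_inv, ← hW.conj]
    group
  refine h.nonempty_ker_mulEquiv (φ := φ) (equivariant hU) (equivariant hV) ?_ P hφ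
    (fun a b => ?_) fun a b => ?_
  · set S := Subgroup.closure (Set.range (Function.uncurry fun a b => U a b * φ (swap a b)) ∪
      Set.range (Function.uncurry fun a b => V a b * φ (swap a b)) ∪ Set.range φ)
    have hS (σ) : φ σ ∈ S := Subgroup.subset_closure (Or.inr ⟨σ, rfl⟩)
    refine gen S hS (fun a b => ?_) fun a b => ?_ <;>
      refine (S.mul_mem_cancel_right (hS (swap a b))).1 (Subgroup.subset_closure ?_)
    · exact Or.inl (Or.inl ⟨(a, b), rfl⟩)
    · exact Or.inl (Or.inr ⟨(a, b), rfl⟩)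
  · rw [hU.map_mul_swap hφ hij (by simp) hPU]
    congr 1
    ext <;> simp [Heis.diff, Heis.inA]
  · rw [hV.map_mul_swap hφ hkl (by simp) hPV]
    congr 1
    ext <;> simp [Heis.diff, Heis.inB]

end IsReflFamily

end ReflectionPairs

theorem hexagon_conj_eq {G : Type*} [Group G] {x : Fin 6 → G} (sq : ∀ k, x k * x k = 1)
    (comm2 : ∀ k, Commute (x k) (x (k + 2))) (comm3 : ∀ k, Commute (x k) (x (k + 3)))
    (braid : ∀ k, x k * x (k + 1) * x k = x (k + 1) * x k * x (k + 1))
    (rel : x 0 * x 1 * x 2 * x 3 * x 4 = x 1 * x 2 * x 3 * x 4 * x 5) (k : Fin 6) :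
    x k = x (k + 5) * x (k + 4) * x (k + 3) * x (k + 2) * x (k + 1) * x (k + 2) * x (k + 3) *
      x (k + 4) * x (k + 5) := by
  have inv (k) : (x k)⁻¹ = x k := inv_eq_of_mul_eq_one_right (sq k)
  have h5 : x 5 = x 4 * x 3 * x 2 * x 1 * x 0 * x 1 * x 2 * x 3 * x 4 := by
    rw [← inv_mul_eq_iff_eq_mul] at rel
    rw [← rel]
    simp only [mul_inv_rev, inv, mul_assoc]
  have step (k : Fin 6) (h : x k = x (k + 5) * x (k + 4) * x (k + 3) * x (k + 2) * x (k + 1) *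
      x (k + 2) * x (k + 3) * x (k + 4) * x (k + 5)) :
      x (k + 1) = x k * x (k + 5) * x (k + 4) * x (k + 3) * x (k + 2) * x (k + 3) * x (k + 4) *
        x (k + 5) * x k := by
    set g := x (k + 5) * x (k + 4) * x (k + 3) with hg
    have hc : Commute (x (k + 1)) g := by
      have c3 := comm2 (k + 1)
      have c4 := comm3 (k + 1)
      have c5 := (comm2 (k + 5)).symm
      simp only [add_assoc] at c3 c4 c5
      exact (c5.mul_right c4).mul_right c3
    have hgi : g⁻¹ = x (k + 3) * x (k + 4) * x (k + 5) := by
      simp only [hg, mul_inv_rev, inv, mul_assoc]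
    have b : x (k + 1) * x (k + 2) * x (k + 1) = x (k + 2) * x (k + 1) * x (k + 2) := by
      have := braid (k + 1)
      rwa [add_assoc] at this
    have h1 : x k = x (k + 1) * (g * x (k + 2) * g⁻¹) * x (k + 1) := by
      calc x k = g * (x (k + 2) * x (k + 1) * x (k + 2)) * g⁻¹ := by
            rw [hgi]
            nth_rw 1 [h]
            simp only [mul_assoc]
        _ = (g * x (k + 1)) * x (k + 2) * (x (k + 1) * g⁻¹) := by
            rw [← b]
            simp only [mul_assoc]
        _ = _ := by
            rw [← hc.eq, hc.inv_right.eq]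
            simp only [mul_assoc]
    have h2 : g * x (k + 2) * g⁻¹ = x (k + 1) * x k * x (k + 1) := by
      rw [h1]
      simp only [mul_assoc, sq, mul_one]
      simp only [← mul_assoc, sq, one_mul]
    calc x (k + 1) = x k * (x k * x (k + 1) * x k) * x k := by
          simp only [mul_assoc, sq, mul_one]
          simp only [← mul_assoc, sq, one_mul]
      _ = x k * (g * x (k + 2) * g⁻¹) * x k := by rw [h2, braid]
      _ = _ := by
          rw [hgi]
          simp only [hg, mul_assoc]
  have h0 := step 5 h5
  have h1 := step 0 h0
  have h2 := step 1 h1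
  have h3 := step 2 h2
  have h4 := step 3 h3
  fin_cases k <;> assumption

section PresentationC

theorem uC_mul_self (e : ET) : uC e * uC e = 1 := by
  exact PresentedGroup.one_of_mem (rels := CRels) (x := fe e * fe e) (Or.inl ⟨e, rfl⟩)

theorem uC_commute {e f : ET} (h : [endA e, endB e, endA f, endB f].Nodup) :
    Commute (uC e) (uC f) := by
  refine PresentedGroup.mk_eq_mk_of_mul_inv_mem (rels := CRels) (x := fe e * fe f)
    (y := fe f * fe e) (Or.inr (Or.inl ⟨e, f, ?_, rfl⟩))
  rintro v ⟨rfl | rfl, h' | h'⟩ <;> simp [h'] at h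

theorem endA_ne_endB (e : ET) : endA e ≠ endB e := by
  revert e
  decide +kernel

theorem eq_of_incidentT {e f : ET} {v w : VT} (hev : incidentT e v) (hfv : incidentT f v)
    (hew : incidentT e w) (hfw : incidentT f w) (hef : e ≠ f) : v = w := by
  have key : ∀ e f : ET, e ≠ f → ¬ (endA e = endA f ∧ endB e = endB f) ∧
      ¬ (endA e = endB f ∧ endB e = endA f) := by decide +kernel
  obtain ⟨h1, h2⟩ := key e f hef
  unfold incidentT at *
  grind

theorem uC_braid {e f : ET} (hef : e ≠ f) (h : ¬ [endA e, endB e, endA f, endB f].Nodup) :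
    uC e * uC f * uC e = uC f * uC e * uC f := by
  refine PresentedGroup.mk_eq_mk_of_mul_inv_mem (rels := CRels) (x := fe e * fe f * fe e)
    (y := fe f * fe e * fe f) (Or.inr (Or.inr (Or.inl ⟨e, f, ?_, rfl⟩)))
  obtain ⟨v, hv⟩ : ∃ v, incidentT e v ∧ incidentT f v := by
    by_contra! hn
    have := endA_ne_endB e
    have := endA_ne_endB f
    unfold incidentT at hn
    simp at h
    grind
  exact ⟨v, hv, fun w hw => eq_of_incidentT hw.1 hw.2 hv.1 hv.2 hef⟩

theorem uC_hexEdge (p : ZMod 3 × ZMod 3) (k : Fin 6) :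
    uC (hexEdge p k) = uC (hexEdge p (k + 5)) * uC (hexEdge p (k + 4)) * uC (hexEdge p (k + 3)) *
      uC (hexEdge p (k + 2)) * uC (hexEdge p (k + 1)) * uC (hexEdge p (k + 2)) *
      uC (hexEdge p (k + 3)) * uC (hexEdge p (k + 4)) * uC (hexEdge p (k + 5)) := by
  refine hexagon_conj_eq (x := fun k => uC (hexEdge p k)) (fun k => uC_mul_self _)
    (fun k => uC_commute ?_) (fun k => uC_commute ?_) (fun k => uC_braid ?_ ?_)
    (PresentedGroup.mk_eq_mk_of_mul_inv_mem (Or.inr (Or.inr (Or.inr ⟨p, rfl⟩)))) k <;>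
  · revert p k
    decide +kernel

theorem uC_hexEdge_mem {S : Subgroup Cgrp} (p : ZMod 3 × ZMod 3) (k : Fin 6)
    (h : ∀ j, j ≠ 0 → uC (hexEdge p (k + j)) ∈ S) : uC (hexEdge p k) ∈ S := by
  rw [uC_hexEdge]
  have h1 := h 1 (by decide)
  have h2 := h 2 (by decide)
  have h3 := h 3 (by decide)
  have h4 := h 4 (by decide)
  have h5 := h 5 (by decide)
  exact mul_mem (mul_mem (mul_mem (mul_mem (mul_mem (mul_mem (mul_mem (mul_mem h5 h4) h3) h2) h1)
    h2) h3) h4) h5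

/-- The monodromy of the torus along the edges of `T`, directed from `endA` to `endB`. -/
def edgeShift (e : ET) : ℤ × ℤ :=
  if e = ((0, 0), 1) ∨ e = ((0, 1), 0) ∨ e = ((1, 2), 1) then (1, 0)
  else if e = ((1, 0), 2) ∨ e = ((2, 0), 2) then (0, 1)
  else if e = ((0, 0), 2) then (1, 1)
  else 0

theorem shiftedSwap_braid {ι : Type*} [DecidableEq ι] [Fintype ι] {i j k : ι} (hij : i ≠ j)
    (hjk : j ≠ k) (hik : i ≠ k) (v w : ℤ × ℤ) :
    shiftedSwap i j v * shiftedSwap j k w * shiftedSwap i j v =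
      shiftedSwap j k w * shiftedSwap i j v * shiftedSwap j k w :=
  (shiftedSwap_conj hij hjk hik v w).trans (shiftedSwap_conj_right hij hjk hik v w).symm

/-- The image of a generator of `C`. -/
def edgeReflection (e : ET) : HeisPerm VT := shiftedSwap (endA e) (endB e) (edgeShift e)

theorem exists_edgeReflection_eq {e : ET} {x : VT} (h : incidentT e x) :
    ∃ a v, a ≠ x ∧ incidentT e a ∧ edgeReflection e = shiftedSwap a x v := by
  rcases h with rfl | rfl
  · exact ⟨endB e, -edgeShift e, (endA_ne_endB e).symm, Or.inr rfl, (shiftedSwap_neg _ _ _).symm⟩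
  · exact ⟨endA e, edgeShift e, endA_ne_endB e, Or.inl rfl, rfl⟩

theorem edgeReflection_hexEdge (p : ZMod 3 × ZMod 3) :
    edgeReflection (hexEdge p 0) * edgeReflection (hexEdge p 1) * edgeReflection (hexEdge p 2) *
        edgeReflection (hexEdge p 3) * edgeReflection (hexEdge p 4) =
      edgeReflection (hexEdge p 1) * edgeReflection (hexEdge p 2) * edgeReflection (hexEdge p 3) *
        edgeReflection (hexEdge p 4) * edgeReflection (hexEdge p 5) := by
  let a : Fin 6 → VT := ![((p.1, p.2 - 1), true), (p, false), (p, true),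
    ((p.1 - 1, p.2), false), ((p.1 - 1, p.2 - 1), true), ((p.1 - 1, p.2 - 1), false)]
  have ha : Function.Injective a := by
    revert p
    decide +kernel
  let s (k : Fin 6) := edgeShift (hexEdge p k)
  have hs : -s 0 + s 1 + s 2 + s 3 + -s 4 + -s 5 = 0 := by
    revert p
    decide +kernel
  have h := shiftedSwap_hexagon ha (v := ![-s 0, s 1, s 2, s 3, -s 4, -s 5]) hs
  have h0 : edgeReflection (hexEdge p 0) = shiftedSwap (a 0) (a 1) (-s 0) :=
    (shiftedSwap_neg _ _ _).symm
  have h4 : edgeReflection (hexEdge p 4) = shiftedSwap (a 4) (a 5) (-s 4) :=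
    (shiftedSwap_neg _ _ _).symm
  have h5 : edgeReflection (hexEdge p 5) = shiftedSwap (a 5) (a 0) (-s 5) :=
    (shiftedSwap_neg _ _ _).symm
  rw [h0, h4, h5]
  exact h

/-- The action of `C` on the abelian cover of the torus. -/
theorem exists_hom_edgeReflection : ∃ P : Cgrp →* HeisPerm VT,
    ∀ e, P (uC e) = edgeReflection e := by
  refine ⟨PresentedGroup.toGroup (f := edgeReflection) ?_, fun e => PresentedGroup.toGroup.of _⟩
  rintro _ (⟨e, rfl⟩ | ⟨e, f, h, rfl⟩ | ⟨e, f, ⟨x, hx, hu⟩, rfl⟩ | ⟨p, rfl⟩) <;>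
    simp only [map_mul, map_inv, fe, FreeGroup.lift_apply_of, mul_inv_eq_one]
  · exact shiftedSwap_mul_self (endA_ne_endB e) _
  · exact shiftedSwap_commute (fun h' => h _ ⟨Or.inl rfl, Or.inl h'⟩)
      (fun h' => h _ ⟨Or.inl rfl, Or.inr h'⟩) (fun h' => h _ ⟨Or.inr rfl, Or.inl h'⟩)
      (fun h' => h _ ⟨Or.inr rfl, Or.inr h'⟩) _ _
  · obtain ⟨a, v, hax, hea, he⟩ := exists_edgeReflection_eq hx.1
    obtain ⟨b, w, hbx, hfb, hf⟩ := exists_edgeReflection_eq hx.2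
    rw [he, hf, ← shiftedSwap_neg b x]
    refine shiftedSwap_braid hax hbx.symm (fun hab => hax (hu a ⟨hea, hab ▸ hfb⟩)) _ _
  · exact edgeReflection_hexEdge p

end PresentationC

section Torus

/-- An enumeration of the triangles along a Hamiltonian path of `T`. -/
noncomputable def triangle : Fin 18 ≃ VT :=
  Equiv.ofBijective ![((1, 2), true), ((1, 2), false), ((2, 2), true), ((2, 2), false),
    ((0, 2), true), ((0, 2), false), ((0, 1), true), ((2, 1), false), ((2, 1), true),
    ((1, 1), false), ((1, 1), true), ((0, 1), false), ((0, 0), true), ((0, 0), false),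
    ((1, 0), true), ((1, 0), false), ((2, 0), true), ((2, 0), false)] (by decide +kernel)

/-- The edges of the Hamiltonian path. -/
def pathEdge : Fin 17 → ET :=
  ![((1, 2), 0), ((2, 2), 1), ((2, 2), 0), ((0, 2), 1), ((0, 2), 0), ((0, 2), 2), ((0, 1), 1),
    ((2, 1), 0), ((2, 1), 1), ((1, 1), 0), ((1, 1), 1), ((0, 1), 2), ((0, 0), 0), ((1, 0), 1),
    ((1, 0), 0), ((2, 0), 1), ((2, 0), 0)]

theorem tE_pathEdge (i : Fin 17) :
    tE (pathEdge i) = swap (triangle i.castSucc) (triangle i.succ) := by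
  have : (endA (pathEdge i) = triangle i.castSucc ∧ endB (pathEdge i) = triangle i.succ) ∨
      (endA (pathEdge i) = triangle i.succ ∧ endB (pathEdge i) = triangle i.castSucc) := by
    revert i
    decide +kernel
  rcases this with ⟨h1, h2⟩ | ⟨h1, h2⟩
  · rw [tE, h1, h2]
  · rw [tE, h1, h2, swap_comm]

theorem uC_mem_of_edgeShift_eq_zero {S : Subgroup Cgrp} (h : ∀ i, uC (pathEdge i) ∈ S) {e : ET}
    (he : edgeShift e = 0) : uC e ∈ S := by
  have key : ∀ e, edgeShift e = 0 → e ∈ Set.range pathEdge ∨ e = hexEdge (0, 2) 3 ∨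
      e = hexEdge (2, 2) 3 ∨ e = hexEdge (1, 1) 0 ∨ e = hexEdge (2, 1) 0 := by decide +kernel
  have hex (p : ZMod 3 × ZMod 3) (k : Fin 6) {f : ET} (hf : uC f ∈ S)
      (hp : ∀ j, j ≠ 0 → hexEdge p (k + j) ∈ Set.range pathEdge ∨ hexEdge p (k + j) = f) :
      uC (hexEdge p k) ∈ S :=
    uC_hexEdge_mem p k fun j hj => by
      rcases hp j hj with ⟨i, hi⟩ | hi
      · exact hi ▸ h i
      · exact hi ▸ hf
  have h1 := hex (0, 2) 3 (h 0) (by decide +kernel)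
  have h2 := hex (1, 1) 0 (h 0) (by decide +kernel)
  rcases key e he with ⟨i, rfl⟩ | rfl | rfl | rfl | rfl
  · exact h i
  · exact h1
  · exact hex (2, 2) 3 h1 (by decide +kernel)
  · exact h2
  · exact hex (2, 1) 0 h2 (by decide +kernel)

/-- The homomorphism `φ` maps the transposition of every edge `e` with zero shift to `u_e`. -/
def LiftsEdges (φ : Perm VT →* Cgrp) : Prop :=
  ∀ e, edgeShift e = 0 → φ (tE e) = uC e

theorem exists_liftsEdges : ∃ φ, LiftsEdges φ := by
  obtain ⟨φ, hφ⟩ := Perm.exists_hom_of_coxeter triangle (fun i => uC (pathEdge (Fin.ofNat 17 i)))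
    (fun i _ => uC_mul_self _)
    (by
      have : ∀ i j : Fin 17, (i : ℕ) + 1 < j → [endA (pathEdge i), endB (pathEdge i),
          endA (pathEdge j), endB (pathEdge j)].Nodup := by decide +kernel
      exact fun i j hij hj => uC_commute (this _ _ (by
        rwa [Fin.val_ofNat, Fin.val_ofNat, Nat.mod_eq_of_lt hj, Nat.mod_eq_of_lt (by omega)])))
    (by
      have : ∀ i < 16, pathEdge (Fin.ofNat 17 i) ≠ pathEdge (Fin.ofNat 17 (i + 1)) ∧
          ¬ [endA (pathEdge (Fin.ofNat 17 i)), endB (pathEdge (Fin.ofNat 17 i)),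
            endA (pathEdge (Fin.ofNat 17 (i + 1))),
            endB (pathEdge (Fin.ofNat 17 (i + 1)))].Nodup := by decide +kernel
      exact fun i hi => uC_braid (this i (by omega)).1 (this i (by omega)).2)
  have hψ : ∃ ψ : Cgrp →* Perm VT, ∀ e, ψ (uC e) = tE e := by
    obtain ⟨P, hP⟩ := exists_hom_edgeReflection
    exact ⟨SemidirectProduct.rightHom.comp P, fun e => by
      rw [MonoidHom.comp_apply, hP]
      rfl⟩
  obtain ⟨ψ, hψ⟩ := hψ
  refine ⟨φ, fun e he => ?_⟩
  have := uC_mem_of_edgeShift_eq_zero (S := (φ.comp ψ).eqLocus (MonoidHom.id _)) (fun i => ?_) he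
  · rw [← hψ]
    exact this
  · have := hφ i
    rw [← tE_pathEdge, Fin.ofNat_val_eq_self] at this
    change φ (ψ (uC (pathEdge i))) = uC (pathEdge i)
    rwa [hψ]

theorem perm_hom_ext {M : Type*} [Monoid M] {f g : Perm VT →* M}
    (h : ∀ e, edgeShift e = 0 → f (tE e) = g (tE e)) : f = g := by
  have hi : ∀ i, edgeShift (pathEdge i) = 0 := by decide +kernel
  let c : Perm (Fin 18) →* Perm VT := triangle.permCongrHom.toMonoidHom
  have key : f.comp c = g.comp c := by
    refine MonoidHom.eq_of_eqOn_denseM (Perm.mclosure_swap_castSucc_succ 17) ?_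
    rintro _ ⟨i, rfl⟩
    have : c (swap i.castSucc i.succ) = tE (pathEdge i) := by
      rw [tE_pathEdge]
      exact Equiv.symm_trans_swap_trans _ _ _
    simpa [this] using h _ (hi i)
  ext σ
  obtain ⟨τ, rfl⟩ := triangle.permCongrHom.surjective σ
  exact DFunLike.congr_fun key τ

/-- The relation between triangles of being joined by an edge with zero shift disjoint from `b`. -/
def IsLinked (b : ET) (x y : VT) : Prop :=
  ∃ e, edgeShift e = 0 ∧ (endA e = x ∧ endB e = y ∨ endA e = y ∧ endB e = x) ∧
    [endA b, endB b, endA e, endB e].Nodup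

instance (b : ET) : DecidableRel (IsLinked b) := fun _ _ => by
  unfold IsLinked
  infer_instance

theorem commute_of_isChain {φ : Perm VT →* Cgrp} (hφ : LiftsEdges φ) (b : ET) {l : List VT}
    {a : VT} (hl : List.IsChain (IsLinked b) (a :: l))
    (hmem : ∀ x, x ≠ endA b → x ≠ endB b → x ∈ a :: l) (σ : Perm VT) (hA : σ (endA b) = endA b)
    (hB : σ (endB b) = endB b) : Commute (φ σ) (uC b) := by
  let S : Subgroup (Perm VT) := (Subgroup.centralizer {uC b}).comap φ
  have hS {σ} : σ ∈ S ↔ Commute (φ σ) (uC b) := Subgroup.mem_centralizer_singleton_iff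
  have chain : List.IsChain (fun x y => swap x y ∈ S) (a :: l) := by
    refine hl.imp fun x y ⟨e, he, hxy, hn⟩ => hS.2 ?_
    have : swap x y = tE e := by
      rcases hxy with ⟨rfl, rfl⟩ | ⟨rfl, rfl⟩
      · rfl
      · exact swap_comm _ _
    rw [this, hφ e he]
    exact (uC_commute hn).symm
  have hsw := swap_mem_of_isChain chain
  refine hS.1 (Perm.mem_of_swap_mem (p := fun x => x ≠ endA b ∧ x ≠ endB b)
    (fun x y hx hy => ?_) fun x hx => ?_)
  · refine SubmonoidClass.swap_mem_trans S ?_ (hsw y (hmem y hy.1 hy.2))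
    rw [swap_comm]
    exact hsw x (hmem x hx.1 hx.2)
  · rw [not_and_or, not_not, not_not] at hx
    rcases hx with rfl | rfl <;> assumption

end Torus

section Families

theorem uC_hexEdge_eq (p : ZMod 3 × ZMod 3) (k : Fin 6) {w₁ w₂ w₃ w₄ : Cgrp}
    (h₁ : uC (hexEdge p (k + 2)) * uC (hexEdge p (k + 1)) * uC (hexEdge p (k + 2)) = w₁)
    (h₂ : uC (hexEdge p (k + 3)) * w₁ * uC (hexEdge p (k + 3)) = w₂)
    (h₃ : uC (hexEdge p (k + 4)) * w₂ * uC (hexEdge p (k + 4)) = w₃)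
    (h₄ : uC (hexEdge p (k + 5)) * w₃ * uC (hexEdge p (k + 5)) = w₄) :
    uC (hexEdge p k) = w₄ := by
  rw [uC_hexEdge, ← h₄, ← h₃, ← h₂, ← h₁]
  simp only [mul_assoc]

variable {φ : Perm VT →* Cgrp}

theorem exists_isReflFamily_edge (hφ : LiftsEdges φ) (b : ET) {l : List VT} {x : VT}
    (hl : List.IsChain (IsLinked b) (x :: l))
    (hmem : ∀ y, y ≠ endA b → y ≠ endB b → y ∈ x :: l) {f g : ET} (hf : edgeShift f = 0)
    (hg : edgeShift g = 0) {c d : VT} (hc : tE f = swap (endB b) c) (hd : tE g = swap (endA b) d)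
    (hcn : [endA b, endB b, c].Nodup) (hdn : [endA b, endB b, d].Nodup)
    (hfn : b ≠ f ∧ ¬ [endA b, endB b, endA f, endB f].Nodup)
    (hgn : b ≠ g ∧ ¬ [endA b, endB b, endA g, endB g].Nodup) :
    ∃ U, IsReflFamily φ U ∧ U (endA b) (endB b) = uC b := by
  simp only [List.nodup_cons, List.mem_cons, List.not_mem_nil, or_false, not_or] at hcn hdn
  refine exists_isReflFamily hcn.1.1 hcn.1.2 hcn.2.1 hdn.1.2 hdn.2.1
    (commute_of_isChain hφ b hl hmem) (uC_mul_self b) ?_ ?_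
  · rw [← hc, hφ f hf, uC_braid hfn.1 hfn.2]
  · rw [← hd, hφ g hg, uC_braid hgn.1 hgn.2]

theorem exists_isReflFamily_horizontal (hφ : LiftsEdges φ) :
    ∃ U, IsReflFamily φ U ∧ U (triangle 11) (triangle 6) = uC ((0, 1), 0) :=
  exists_isReflFamily_edge hφ ((0, 1), 0) (x := triangle 7)
    (l := [8, 9, 10, 1, 0, 1, 2, 3, 4, 5, 4, 3, 8, 9, 14, 13, 12, 13, 14, 15, 16, 17].map triangle)
    (by decide +kernel) (by decide +kernel) (f := pathEdge 6) (g := pathEdge 11)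
    (by decide +kernel) (by decide +kernel) (tE_pathEdge 6) (tE_pathEdge 11) (by decide +kernel)
    (by decide +kernel) (by decide +kernel) (by decide +kernel)

theorem exists_isReflFamily_vertical (hφ : LiftsEdges φ) :
    ∃ V, IsReflFamily φ V ∧ V (triangle 15) (triangle 0) = uC ((1, 0), 2) :=
  exists_isReflFamily_edge hφ ((1, 0), 2) (x := triangle 17)
    (l := [16, 7, 6, 5, 4, 3, 2, 1, 10, 9, 8, 9, 10, 11, 12, 13, 14].map triangle)
    (by decide +kernel) (by decide +kernel) (f := pathEdge 0) (g := pathEdge 15)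
    (by decide +kernel) (by decide +kernel) (tE_pathEdge 0) (tE_pathEdge 15) (by decide +kernel)
    (by decide +kernel) (by decide +kernel) (by decide +kernel)

namespace IsReflFamily

variable {U V : VT → VT → Cgrp}

theorem uC_mul_mul_uC (hφ : LiftsEdges φ) (hU : IsReflFamily φ U) {e : ET} {a b a' b' : VT}
    (h : edgeShift e = 0 ∧ tE e a = a' ∧ tE e b = b') : uC e * U a b * uC e = U a' b' := by
  obtain ⟨he, rfl, rfl⟩ := h
  rw [← hU.conj, hφ e he, inv_eq_of_mul_eq_one_right (uC_mul_self e)]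

theorem uC_mul_conj_mul_uC (hφ : LiftsEdges φ) (hU : IsReflFamily φ U) (hV : IsReflFamily φ V)
    {e : ET}
    {a b c d a' b' c' d' : VT}
    (h : edgeShift e = 0 ∧ tE e a = a' ∧ tE e b = b' ∧ tE e c = c' ∧ tE e d = d') :
    uC e * (V a b * U c d * V a b) * uC e = V a' b' * U c' d' * V a' b' := by
  rw [← hV.uC_mul_mul_uC hφ (e := e) ⟨h.1, h.2.1, h.2.2.1⟩,
    ← hU.uC_mul_mul_uC hφ (e := e) ⟨h.1, h.2.2.2⟩]
  have (g : Cgrp) : uC e * (uC e * g) = g := by rw [← mul_assoc, uC_mul_self, one_mul]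
  simp only [mul_assoc, this]

theorem conj_left_of_uC_eq (hφ : LiftsEdges φ) (hU : IsReflFamily φ U) {e f : ET} {a b c : VT}
    (hf : uC f = U a b)
    (h : edgeShift e = 0 ∧ tE e = swap b c ∧ [a, b, c].Nodup) :
    uC f * uC e * uC f = U a c := by
  obtain ⟨he, h, hn⟩ := h
  simp only [List.nodup_cons, List.mem_cons, List.not_mem_nil, or_false, not_or] at hn
  rw [hf, ← hφ e he, h, hU.conj_left hn.1.1 hn.1.2 hn.2.1]

theorem conj_right_of_uC_eq (hφ : LiftsEdges φ) (hU : IsReflFamily φ U) {e f : ET} {a b c : VT}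
    (hf : uC f = U a b)
    (h : edgeShift e = 0 ∧ tE e = swap a c ∧ [a, b, c].Nodup) :
    uC f * uC e * uC f = U c b := by
  obtain ⟨he, h, hn⟩ := h
  simp only [List.nodup_cons, List.mem_cons, List.not_mem_nil, or_false, not_or] at hn
  rw [hf, ← hφ e he, h, hU.conj_right hn.1.1 hn.1.2 hn.2.1]

theorem uC_eq_zero_five (hφ : LiftsEdges φ) (hU : IsReflFamily φ U)
    (h : U (triangle 11) (triangle 6) = uC ((0, 1), 0)) :
    uC ((1, 2), 1) = U (triangle 0) (triangle 5) :=
  uC_hexEdge_eq (1, 2) 2 (w₁ := U (triangle 11) (triangle 5)) (w₂ := U (triangle 10) (triangle 5))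
    (w₃ := U (triangle 1) (triangle 5))
    (hU.conj_left_of_uC_eq hφ h.symm (by decide +kernel))
    (hU.uC_mul_mul_uC hφ (by decide +kernel)) (hU.uC_mul_mul_uC hφ (by decide +kernel))
    (hU.uC_mul_mul_uC hφ (by decide +kernel))

theorem uC_eq_twelve_seventeen (hφ : LiftsEdges φ) (hU : IsReflFamily φ U)
    (h : U (triangle 11) (triangle 6) = uC ((0, 1), 0)) :
    uC ((0, 0), 1) = U (triangle 12) (triangle 17) :=
  uC_hexEdge_eq (0, 1) 5 (w₁ := U (triangle 12) (triangle 6)) (w₂ := U (triangle 12) (triangle 7))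
    (w₃ := U (triangle 12) (triangle 16))
    (hU.conj_right_of_uC_eq hφ h.symm (by decide +kernel))
    (hU.uC_mul_mul_uC hφ (by decide +kernel)) (hU.uC_mul_mul_uC hφ (by decide +kernel))
    (hU.uC_mul_mul_uC hφ (by decide +kernel))

theorem uC_eq_seventeen_two (hφ : LiftsEdges φ) (hV : IsReflFamily φ V)
    (h : V (triangle 15) (triangle 0) = uC ((1, 0), 2)) :
    uC ((2, 0), 2) = V (triangle 17) (triangle 2) := by
  have hn : [triangle 15, triangle 0, triangle 17].Nodup := by decide +kernel
  simp only [List.nodup_cons, List.mem_cons, List.not_mem_nil, or_false, not_or] at hn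
  refine uC_hexEdge_eq (2, 0) 0 (w₁ := φ (swap (triangle 15) (triangle 17)))
    (w₂ := V (triangle 17) (triangle 0)) (w₃ := V (triangle 17) (triangle 1)) ?_ ?_
    (hV.uC_mul_mul_uC hφ (by decide +kernel)) (hV.uC_mul_mul_uC hφ (by decide +kernel))
  · rw [← hφ _ (by decide +kernel), ← hφ (hexEdge (2, 0) (0 + 1)) (by decide +kernel), ← map_mul,
      ← map_mul]
    congr 1
    decide +kernel
  · rw [← hV.conj_right hn.1.1 hn.1.2 hn.2.1, h]
    rfl

theorem uC_corner (hφ : LiftsEdges φ) (hU : IsReflFamily φ U) (hV : IsReflFamily φ V)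
    (h : U (triangle 11) (triangle 6) = uC ((0, 1), 0))
    (h' : V (triangle 15) (triangle 0) = uC ((1, 0), 2)) :
    uC ((0, 0), 2) = V (triangle 17) (triangle 4) * U (triangle 13) (triangle 17) *
      V (triangle 17) (triangle 4) :=
  uC_hexEdge_eq (0, 0) 0
    (hU.conj_right_of_uC_eq hφ (hU.uC_eq_twelve_seventeen hφ h) (c := triangle 13)
      (by decide +kernel))
    (congrArg (fun g => g * U (triangle 13) (triangle 17) * g) (hV.uC_eq_seventeen_two hφ h'))
    (uC_mul_conj_mul_uC hφ hU hV (a' := triangle 17) (b' := triangle 3) (c' := triangle 13)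
      (d' := triangle 17) (by decide +kernel))
    (uC_mul_conj_mul_uC hφ hU hV (by decide +kernel))

theorem corner_uC (hφ : LiftsEdges φ) (hU : IsReflFamily φ U) (hV : IsReflFamily φ V)
    (h : U (triangle 11) (triangle 6) = uC ((0, 1), 0))
    (h' : V (triangle 15) (triangle 0) = uC ((1, 0), 2)) :
    uC ((0, 0), 2) = V (triangle 13) (triangle 0) * U (triangle 0) (triangle 4) *
      V (triangle 13) (triangle 0) :=
  uC_hexEdge_eq (1, 0) 3
    (hU.conj_left_of_uC_eq hφ (hU.uC_eq_zero_five hφ h) (c := triangle 4) (by decide +kernel))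
    (congrArg (fun g => g * U (triangle 0) (triangle 4) * g) h'.symm)
    (uC_mul_conj_mul_uC hφ hU hV (a' := triangle 14) (b' := triangle 0) (c' := triangle 0)
      (d' := triangle 4) (by decide +kernel))
    (uC_mul_conj_mul_uC hφ hU hV (by decide +kernel))

end IsReflFamily

end Families

theorem shiftedSwap_zero {ι : Type*} [DecidableEq ι] [Fintype ι] (i j : ι) :
    shiftedSwap i j 0 = SemidirectProduct.inr (swap i j) := by
  refine SemidirectProduct.ext ?_ rfl
  ext <;> simp [shiftedSwap, Heis.diff]

theorem nonempty_ker_mulEquiv_sumHom {P : Cgrp →* HeisPerm VT}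
    (hP : ∀ e, P (uC e) = edgeReflection e) :
    Nonempty ((SemidirectProduct.rightHom.comp P).ker ≃* (Heis.sumHom (ι := VT)).ker) := by
  obtain ⟨φ, hφ⟩ := exists_liftsEdges
  obtain ⟨U, hU, hUe⟩ := exists_isReflFamily_horizontal hφ
  obtain ⟨V, hV, hVe⟩ := exists_isReflFamily_vertical hφ
  have hPφ : P.comp φ = SemidirectProduct.inr := perm_hom_ext fun e he => by
    rw [MonoidHom.comp_apply, hφ e he, hP, edgeReflection, he, shiftedSwap_zero, tE]
  have corner := (hU.uC_corner hφ hV hUe hVe).symm.trans (hU.corner_uC hφ hV hUe hVe)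
  refine hU.nonempty_ker_mulEquiv hV (hU.isDiffPair hV (fun l hl => ?_) (i := triangle 11)
    (j := triangle 6) (k := triangle 15) (l := triangle 0) (by decide +kernel) ?_
    (a := triangle 13) (b := triangle 17) (c := triangle 4) (d := triangle 0) (by decide +kernel)
    corner) (fun S hSφ hSU hSV => ?_) (DFunLike.congr_fun hPφ) (i := triangle 11) (j := triangle 6)
    (k := triangle 15) (l := triangle 0) (by decide +kernel) ?_ (by decide +kernel) ?_
  · by_contra! hx
    have h1 := Finset.card_le_card (fun x _ => List.mem_toFinset.2 (hx x) :
      (Finset.univ : Finset VT) ⊆ l.toFinset)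
    have h2 := l.toFinset_card_le
    simp at h1
    omega
  · rw [hUe, hVe]
    exact uC_commute (by decide +kernel)
  · rw [eq_top_iff, ← PresentedGroup.closure_range_of, Subgroup.closure_le]
    rintro _ ⟨e, rfl⟩
    change uC e ∈ S
    have he : edgeShift e = 0 ∨ e = ((0, 1), 0) ∨ e = ((1, 2), 1) ∨ e = ((0, 0), 1) ∨
        e = ((1, 0), 2) ∨ e = ((2, 0), 2) ∨ e = ((0, 0), 2) := by
      revert e
      decide +kernel
    rcases he with he | rfl | rfl | rfl | rfl | rfl | rfl
    · exact hφ e he ▸ hSφ _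
    · exact hUe ▸ hSU _ _
    · exact hU.uC_eq_zero_five hφ hUe ▸ hSU _ _
    · exact hU.uC_eq_twelve_seventeen hφ hUe ▸ hSU _ _
    · exact hVe ▸ hSV _ _
    · exact hV.uC_eq_seventeen_two hφ hVe ▸ hSV _ _
    · exact hU.uC_corner hφ hV hUe hVe ▸ mul_mem (mul_mem (hSV _ _) (hSU _ _)) (hSV _ _)
  · rw [hUe, hP]
    rfl
  · rw [hVe, hP]
    rfl

/-- The kernel of `ψ_C : C → S₁₈` is isomorphic to the group `K = ker(ab)`. -/
theorem stmt17 (ψ : Cgrp →* Equiv.Perm VT)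
    (hψ : ∀ e : ET, ψ (uC e) = tE e) (hsurj : Function.Surjective ψ)
    (ab : Hgrp →* Multiplicative (ℤ × ℤ))
    (habx : ∀ i : Fin 18, ab (xH i) = Multiplicative.ofAdd (1, 0))
    (haby : ∀ i : Fin 18, ab (yH i) = Multiplicative.ofAdd (0, 1))
    (habz : ab zH = 1) :
    Nonempty (↥ψ.ker ≃* ↥ab.ker) := by
  obtain ⟨P, hP⟩ := exists_hom_edgeReflection
  obtain rfl : ψ = SemidirectProduct.rightHom.comp P := PresentedGroup.ext fun e => by
    change ψ (uC e) = SemidirectProduct.rightHom (P (uC e))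
    rw [hψ, hP]
    rfl
  obtain rfl : ab = Heis.sumHom.comp (toHeis triangle) := PresentedGroup.ext fun g => by
    rcases g with i | i | _
    · change ab (xH i) = Heis.sumHom (toHeis triangle (xH i))
      rw [habx, toHeis_x]
      simp [Heis.sumHom]
    · change ab (yH i) = Heis.sumHom (toHeis triangle (yH i))
      rw [haby, toHeis_y]
      simp [Heis.sumHom]
    · change ab zH = Heis.sumHom (toHeis triangle zH)
      rw [habz, toHeis_z]
      exact (Heis.sumHom_eq_one.2 ⟨by simp, by simp⟩).symm
  obtain ⟨E⟩ := nonempty_ker_mulEquiv_sumHom hP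
  let T := MulEquiv.ofBijective _ (toHeis_bijective triangle)
  have hT : (Heis.sumHom.comp (toHeis triangle)).ker.map T.toMonoidHom = Heis.sumHom.ker := by
    rw [← MonoidHom.comap_ker]
    exact Subgroup.map_comap_eq_self_of_surjective T.surjective _
  exact ⟨E.trans ((T.subgroupMap _).trans (MulEquiv.subgroupCongr hT)).symm⟩
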